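/- Let K be a field of characteristic p, and let f_1, ..., f_r ∈ K[T,X] be pairwise non-associate absolutely irreducible polynomials such that for each i, writing d_i for the total degree of f_i, one has d_i ≥ 2, p does not divide d_i(d_i − 1), and the projective plane curve defined by the homogenization of f_i is smooth. Let A and B be two independent variables, let f = f_1 ⋯ f_r, and regard f(T, A·T + B) as a polynomial in T over the rational function field K(A,B). Then the Galois group of the splitting field of f(T, A·T + B) over K(A,B) is isomorphic to the direct product S_{d_1} × ⋯ × S_{d_r} of symmetric groups. -/

import Mathlib

open MvPolynomial

/-- `f ∈ K[T,X]` is absolutely irreducible: it is irreducible over an algebraic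
closure of `K`. -/
def AbsolutelyIrreducible {K : Type*} [Field K] (f : MvPolynomial (Fin 2) K) : Prop :=
  Irreducible (MvPolynomial.map (algebraMap K (AlgebraicClosure K)) f)

/-- `F ∈ K[X₀,X₁,X₂]` is the degree-`d` homogenization of `f ∈ K[T,X]`
(so `F` is homogeneous of degree `d` with `F(1,T,X) = f(T,X)`) and the projective
plane curve `F = 0` is smooth: `F` and its three partial derivatives have no common
zero `≠ (0,0,0)` with coordinates in an algebraic closure of `K`. -/
def IsSmoothHomogenization {K : Type*} [Field K] (F : MvPolynomial (Fin 3) K)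
    (f : MvPolynomial (Fin 2) K) (d : ℕ) : Prop :=
  F.IsHomogeneous d ∧
  MvPolynomial.aeval ![1, MvPolynomial.X 0, MvPolynomial.X 1] F = f ∧
  ∀ x : Fin 3 → AlgebraicClosure K, x ≠ 0 →
    MvPolynomial.eval x (F.map (algebraMap K (AlgebraicClosure K))) = 0 →
    ∃ j : Fin 3, MvPolynomial.eval x ((MvPolynomial.pderiv j F).map
      (algebraMap K (AlgebraicClosure K))) ≠ 0

/-- `f(T, A·T + B)`, regarded as a polynomial in `T` over the rational function field
`K(A,B) = Frac(K[A,B])` (the substitution `X := A·T + B` applied to `f ∈ K[T,X]`,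
where variable `0` of `f` is `T` and variable `1` is `X`). -/
noncomputable def lineSubAB {K : Type*} [Field K] (f : MvPolynomial (Fin 2) K) :
    Polynomial (FractionRing (MvPolynomial (Fin 2) K)) :=
  MvPolynomial.aeval
    ![Polynomial.X,
      Polynomial.C (algebraMap (MvPolynomial (Fin 2) K)
          (FractionRing (MvPolynomial (Fin 2) K)) (MvPolynomial.X 0)) * Polynomial.X +
        Polynomial.C (algebraMap (MvPolynomial (Fin 2) K)
          (FractionRing (MvPolynomial (Fin 2) K)) (MvPolynomial.X 1))] f

noncomputable section Lin
variable {K : Type*} [Field K] {R S : Type*} [CommRing R] [Algebra K R] [CommRing S] [Algebra K S]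

/-- `f(T, aT+b)` over a `K`-algebra. -/
def lin (a b : R) (f : MvPolynomial (Fin 2) K) : Polynomial R :=
  MvPolynomial.aeval ![Polynomial.X, Polynomial.C a * Polynomial.X + Polynomial.C b] f

theorem lin_eval (a b y : R) (f : MvPolynomial (Fin 2) K) :
    (lin a b f).eval y = MvPolynomial.aeval ![y, a * y + b] f := by
  induction f using MvPolynomial.induction_on with
  | C c => simp [lin, Polynomial.algebraMap_apply]
  | add p q hp hq => simp_all [lin]
  | mul_X p i hp =>
    simp only [lin, map_mul, Polynomial.eval_mul] at hp ⊢
    rw [hp]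
    fin_cases i <;> simp

theorem lin_map (a b : R) (f : MvPolynomial (Fin 2) K) (φ : R →ₐ[K] S) :
    (lin a b f).map (φ : R →+* S) = lin (φ a) (φ b) f := by
  induction f using MvPolynomial.induction_on with
  | C c => simp [lin, Polynomial.algebraMap_apply]
  | add p q hp hq => simp_all [lin]
  | mul_X p i hp =>
    simp only [lin, map_mul, Polynomial.map_mul] at hp ⊢
    rw [hp]
    fin_cases i <;> simp

theorem lin_mul (a b : R) (f g : MvPolynomial (Fin 2) K) :
    lin a b (f * g) = lin a b f * lin a b g := map_mul _ _ _

theorem lin_prod (a b : R) {ι : Type*} (s : Finset ι) (f : ι → MvPolynomial (Fin 2) K) :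
    lin a b (∏ i ∈ s, f i) = ∏ i ∈ s, lin a b (f i) := map_prod _ _ _

theorem lin_derivative (a b : R) (f : MvPolynomial (Fin 2) K) :
    Polynomial.derivative (lin a b f) =
      lin a b (pderiv 0 f) + Polynomial.C a * lin a b (pderiv 1 f) := by
  induction f using MvPolynomial.induction_on with
  | C c => simp [lin, Polynomial.algebraMap_apply]
  | add p q hp hq =>
    simp only [lin, map_add] at hp hq ⊢
    rw [hp, hq]; ring
  | mul_X p i hp =>
    simp only [lin] at hp
    simp only [lin, map_mul, Polynomial.derivative_mul, hp, Derivation.leibniz, map_add,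
      smul_eq_mul]
    fin_cases i <;> simp <;> ring

theorem taylor2 (f : MvPolynomial (Fin 2) K) (t x u v s : R) :
    ∃ e : R, aeval ![t + s * u, x + s * v] f =
      aeval ![t, x] f + s * (u * aeval ![t, x] (pderiv 0 f) + v * aeval ![t, x] (pderiv 1 f))
        + s ^ 2 * e := by
  induction f using MvPolynomial.induction_on with
  | C c => exact ⟨0, by simp⟩
  | add p q hp hq =>
    obtain ⟨e, he⟩ := hp
    obtain ⟨e', he'⟩ := hq
    refine ⟨e + e', ?_⟩
    simp only [map_add, he, he']; ring
  | mul_X p i hp =>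
    obtain ⟨e, he⟩ := hp
    simp only [map_mul, he, Derivation.leibniz, map_add, smul_eq_mul]
    fin_cases i
    · refine ⟨e * (t + s * u) + u * (u * aeval ![t, x] (pderiv 0 p)
        + v * aeval ![t, x] (pderiv 1 p)), ?_⟩
      simp
      ring
    · refine ⟨e * (x + s * v) + v * (u * aeval ![t, x] (pderiv 0 p)
        + v * aeval ![t, x] (pderiv 1 p)), ?_⟩
      simp
      ring

theorem aeval_pair_map (φ : R →ₐ[K] S) (t x : R) (f : MvPolynomial (Fin 2) K) :
    φ (aeval ![t, x] f) = aeval ![φ t, φ x] f := by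
  rw [← AlgHom.comp_apply, comp_aeval]
  congr 2
  ext i; fin_cases i <;> simp

end Lin

theorem exists_point (K A : Type*) [Field K] [IsAlgClosed K] [CommRing A] [Nontrivial A]
    [Algebra K A] [Algebra.FiniteType K A] : Nonempty (A →ₐ[K] K) := by
  obtain ⟨I, hI⟩ := Ideal.exists_maximal A
  have : Algebra.FiniteType K (A ⧸ I) := inferInstance
  let : Field (A ⧸ I) := Ideal.Quotient.field I
  have hfin : Module.Finite K (A ⧸ I) := finite_of_finite_type_of_isJacobsonRing K (A ⧸ I)
  have halg : Algebra.IsAlgebraic K (A ⧸ I) := Algebra.IsAlgebraic.of_finite K _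
  exact ⟨(IsAlgClosed.lift (M := K) (R := K) (S := A ⧸ I)).comp (Ideal.Quotient.mkₐ K I)⟩

theorem exists_coeff_of_not_isUnit {σ k : Type*} [Field k] (g : MvPolynomial σ k) (h0 : g ≠ 0)
    (hu : ¬ IsUnit g) : ∃ m, m ≠ 0 ∧ g.coeff m ≠ 0 := by
  classical
  by_contra! h
  apply hu
  have : g = C (g.coeff 0) := by
    ext m
    rw [coeff_C]
    split_ifs with hm
    · rw [hm]
    · exact h m (Ne.symm hm)
  rw [this]
  apply IsUnit.map
  rw [isUnit_iff_ne_zero]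
  rintro h'
  rw [h'] at this
  exact h0 (by simpa using this)

/-- irreducibility over an algebraically closed field is inherited by extensions -/
theorem irreducible_map_of_isAlgClosed {K k : Type*} [Field K] [IsAlgClosed K] [Field k]
    [Algebra K k] {σ : Type*} [Finite σ] {f : MvPolynomial σ K} (hf : Irreducible f) :
    Irreducible (f.map (algebraMap K k)) := by
  classical
  have hinj := MvPolynomial.map_injective (σ := σ) _ (algebraMap K k).injective
  have hunit : ∀ (g : MvPolynomial σ K), IsUnit g → ∀ m, m ≠ 0 → g.coeff m = 0 := by
    intro g hg m hm
    obtain ⟨c, hc, rfl⟩ := MvPolynomial.isUnit_iff_eq_C_of_isReduced.mp hg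
    rw [coeff_C, if_neg (Ne.symm hm)]
  constructor
  · intro hu
    obtain ⟨m, hm, hc⟩ := exists_coeff_of_not_isUnit f hf.ne_zero hf.not_isUnit
    obtain ⟨c, hc', h⟩ := MvPolynomial.isUnit_iff_eq_C_of_isReduced.mp hu
    have := congrArg (coeff m) h
    rw [coeff_C, if_neg (Ne.symm hm), coeff_map] at this
    exact hc (by simpa using this)
  · intro g h hgh
    by_contra! hcon
    have hne : f.map (algebraMap K k) ≠ 0 := by
      intro h'; exact hf.ne_zero (hinj (by simpa using h'))
    have hg0 : g ≠ 0 := by rintro rfl; simp at hgh; exact hne (by simpa using hgh)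
    have hh0 : h ≠ 0 := by rintro rfl; simp at hgh; exact hne (by simpa using hgh)
    obtain ⟨m, hm, hgm⟩ := exists_coeff_of_not_isUnit g hg0 hcon.1
    obtain ⟨n, hn, hhn⟩ := exists_coeff_of_not_isUnit h hh0 hcon.2
    let T : Finset k := g.support.image (fun m => g.coeff m) ∪ h.support.image (fun m => h.coeff m)
      ∪ {(g.coeff m * h.coeff n)⁻¹}
    let A : Subalgebra K k := Algebra.adjoin K (T : Set k)
    have hA : ∀ x ∈ T, x ∈ A := fun x hx => Algebra.subset_adjoin hx
    have hgA : ∀ m, g.coeff m ∈ A := by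
      intro m
      by_cases h' : m ∈ g.support
      · apply hA; simp only [T, Finset.mem_union, Finset.mem_image]; exact .inl (.inl ⟨m, h', rfl⟩)
      · rw [notMem_support_iff.mp h']; exact A.zero_mem
    have hhA : ∀ m, h.coeff m ∈ A := by
      intro m
      by_cases h' : m ∈ h.support
      · apply hA; simp only [T, Finset.mem_union, Finset.mem_image]; exact .inl (.inr ⟨m, h', rfl⟩)
      · rw [notMem_support_iff.mp h']; exact A.zero_mem
    have hft : Algebra.FiniteType K A :=
      (Subalgebra.fg_iff_finiteType A).mp ⟨T, rfl⟩
    obtain ⟨φ⟩ := exists_point K A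
    obtain ⟨g', hg'⟩ : ∃ g' : MvPolynomial σ A, g'.map A.val.toRingHom = g := by
      rw [← Set.mem_range, MvPolynomial.mem_range_map_iff_coeffs_subset]
      intro c hc
      obtain ⟨m, -, rfl⟩ := mem_coeffs_iff.mp hc
      exact ⟨⟨_, hgA m⟩, rfl⟩
    obtain ⟨h', hh'⟩ : ∃ h' : MvPolynomial σ A, h'.map A.val.toRingHom = h := by
      rw [← Set.mem_range, MvPolynomial.mem_range_map_iff_coeffs_subset]
      intro c hc
      obtain ⟨m, -, rfl⟩ := mem_coeffs_iff.mp hc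
      exact ⟨⟨_, hhA m⟩, rfl⟩
    have hfA : f.map (algebraMap K A) = g' * h' := by
      apply MvPolynomial.map_injective A.val.toRingHom Subtype.val_injective
      rw [map_mul, hg', hh', ← hgh, map_map]
      rfl
    have hfK : f = g'.map φ.toRingHom * h'.map φ.toRingHom := by
      rw [← map_mul, ← hfA, map_map]
      have : φ.toRingHom.comp (algebraMap K A) = RingHom.id K := by
        ext x; exact φ.commutes x
      rw [this, map_id]
    have hinvA : (g.coeff m * h.coeff n)⁻¹ ∈ A := by
      apply hA; simp [T]
    have hu : φ (g'.coeff m) * φ (h'.coeff n) ≠ 0 := by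
      have h1 : (g'.coeff m * h'.coeff n) * ⟨_, hinvA⟩ = 1 := by
        apply Subtype.ext
        have e1 : ((g'.coeff m : A) : k) = g.coeff m := by
          rw [← hg', coeff_map]; rfl
        have e2 : ((h'.coeff n : A) : k) = h.coeff n := by
          rw [← hh', coeff_map]; rfl
        simp only [MulMemClass.coe_mul, e1, e2, OneMemClass.coe_one]
        exact mul_inv_cancel₀ (mul_ne_zero hgm hhn)
      have h2 := congrArg φ h1
      rw [map_mul, map_mul, map_one] at h2
      exact left_ne_zero_of_mul_eq_one h2
    rcases hf.isUnit_or_isUnit hfK with h1 | h1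
    · have := hunit _ h1 m hm
      rw [coeff_map] at this
      exact (left_ne_zero_of_mul hu) this
    · have := hunit _ h1 n hn
      rw [coeff_map] at this
      exact (right_ne_zero_of_mul hu) this

/-- generic points of a plane curve -/
theorem generic_dvd {k E : Type*} [Field k] [Field E] [Algebra k E]
    {f : MvPolynomial (Fin 2) k} (hf : Irreducible f) {t x : E} (h0 : aeval ![t, x] f = 0)
    (hna : ¬ (IsAlgebraic k t ∧ IsAlgebraic k x)) (g : MvPolynomial (Fin 2) k) :
    aeval ![t, x] g = 0 ↔ f ∣ g := by
  constructor
  swap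
  · rintro ⟨h, rfl⟩; rw [map_mul, h0, zero_mul]
  intro hg
  by_contra hfg
  let P : Ideal (MvPolynomial (Fin 2) k) := RingHom.ker (aeval (R := k) ![t, x])
  have hP : P.IsPrime := RingHom.ker_isPrime _
  have hfp : (Ideal.span {f}).IsPrime := by
    rw [Ideal.span_singleton_prime hf.ne_zero]; exact hf.prime
  have hlt1 : (⊥ : Ideal (MvPolynomial (Fin 2) k)) < Ideal.span {f} := by
    rw [bot_lt_iff_ne_bot, Ne, Ideal.span_singleton_eq_bot]; exact hf.ne_zero
  have hlt2 : Ideal.span {f} < P := by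
    rw [lt_iff_le_and_ne]
    constructor
    · rw [Ideal.span_singleton_le_iff_mem]; exact h0
    · intro h
      apply hfg
      rw [← Ideal.mem_span_singleton, h]
      exact hg
  have hmax : P.IsMaximal := by
    obtain ⟨m, hm, hle⟩ := Ideal.exists_le_maximal P hP.ne_top
    rcases hle.eq_or_lt with h | h
    · rwa [h]
    exfalso
    have hdim := MvPolynomial.ringKrullDim_of_isNoetherianRing (R := k) (ι := Fin 2)
    rw [ringKrullDim_eq_zero_of_field, zero_add] at hdim
    let q : LTSeries (PrimeSpectrum (MvPolynomial (Fin 2) k)) :=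
      { length := 3
        toFun := ![⟨⊥, Ideal.isPrime_bot⟩, ⟨_, hfp⟩, ⟨P, hP⟩, ⟨m, hm.isPrime⟩]
        step := by
          intro i
          fin_cases i
          · exact hlt1
          · exact hlt2
          · exact h }
    have := Order.LTSeries.length_le_krullDim q
    change _ ≤ ringKrullDim _ at this
    rw [hdim] at this
    simp [q] at this
    exact absurd this (by decide)
  apply hna
  let : Field (MvPolynomial (Fin 2) k ⧸ P) := Ideal.Quotient.field P
  have hfin : Module.Finite k (MvPolynomial (Fin 2) k ⧸ P) :=
    finite_of_finite_type_of_isJacobsonRing k _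
  have halg : Algebra.IsAlgebraic k (MvPolynomial (Fin 2) k ⧸ P) := Algebra.IsAlgebraic.of_finite k _
  let φ : (MvPolynomial (Fin 2) k ⧸ P) →ₐ[k] E := Ideal.Quotient.liftₐ P (aeval ![t, x])
    (fun a ha => ha)
  have e1 : φ (Ideal.Quotient.mk P (X 0)) = t := by
    change aeval ![t, x] (X 0 : MvPolynomial (Fin 2) k) = t
    simp
  have e2 : φ (Ideal.Quotient.mk P (X 1)) = x := by
    change aeval ![t, x] (X 1 : MvPolynomial (Fin 2) k) = x
    simp
  constructor
  · rw [← e1]; exact (halg.isAlgebraic _).algHom φ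
  · rw [← e2]; exact (halg.isAlgebraic _).algHom φ

section HC
variable {k : Type*} [Field k]

theorem sum_hc_of_le {σ : Type*} (p : MvPolynomial σ k) {n : ℕ} (h : p.totalDegree ≤ n) :
    ∑ i ∈ Finset.range (n + 1), homogeneousComponent i p = p := by
  conv_rhs => rw [← sum_homogeneousComponent p]
  symm
  apply Finset.sum_subset
  · intro i; simp; omega
  · intro i _ hi
    apply homogeneousComponent_eq_zero
    simp at hi; omega

theorem hc_mul {σ : Type*} {p q : MvPolynomial σ k} {a b : ℕ} (hp : p.totalDegree ≤ a)
    (hq : q.totalDegree ≤ b) : homogeneousComponent (a + b) (p * q) =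
      homogeneousComponent a p * homogeneousComponent b q := by
  conv_lhs => rw [← sum_hc_of_le p hp, ← sum_hc_of_le q hq, Finset.sum_mul_sum, map_sum]
  rw [Finset.sum_eq_single a]
  · rw [map_sum, Finset.sum_eq_single b]
    · exact homogeneousComponent_eq_self
        ((homogeneousComponent_isHomogeneous _ _).mul (homogeneousComponent_isHomogeneous _ _))
    · intro j hj hne
      rw [homogeneousComponent_of_mem ((homogeneousComponent_isHomogeneous a p).mul
        (homogeneousComponent_isHomogeneous j q)), if_neg]
      omega
    · simp
  · intro i hi hne
    rw [map_sum]
    apply Finset.sum_eq_zero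
    intro j hj
    rw [homogeneousComponent_of_mem ((homogeneousComponent_isHomogeneous i p).mul
        (homogeneousComponent_isHomogeneous j q)), if_neg]
    simp at hi hj
    omega
  · simp

theorem totalDegree_le_pred {σ : Type*} {p : MvPolynomial σ k} {n : ℕ} (hp : p.totalDegree ≤ n)
    (h0 : homogeneousComponent n p = 0) : p.totalDegree ≤ n - 1 := by
  rw [← sum_hc_of_le p hp, Finset.sum_range_succ, h0, add_zero]
  apply totalDegree_finsetSum_le
  intro i hi
  have := (homogeneousComponent_isHomogeneous i p).totalDegree_le
  simp at hi
  omega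

theorem hc_pderiv {σ : Type*} (i : σ) (n : ℕ) (f : MvPolynomial σ k) :
    homogeneousComponent n (pderiv i f) = pderiv i (homogeneousComponent (n + 1) f) := by
  ext m
  rw [coeff_homogeneousComponent, coeff_pderiv, coeff_pderiv, coeff_homogeneousComponent]
  simp only [map_add, Finsupp.degree_single]
  simp

theorem totalDegree_pderiv_le {σ : Type*} (i : σ) (f : MvPolynomial σ k) :
    (pderiv i f).totalDegree ≤ f.totalDegree - 1 := by
  conv_lhs => rw [← sum_homogeneousComponent f, map_sum]
  apply totalDegree_finsetSum_le
  intro j hj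
  have := ((homogeneousComponent_isHomogeneous j f).pderiv (i := i)).totalDegree_le
  simp at hj
  omega

theorem pderiv_pderiv_comm {σ : Type*} (i j : σ) (f : MvPolynomial σ k) :
    pderiv i (pderiv j f) = pderiv j (pderiv i f) := by
  classical
  induction f using MvPolynomial.induction_on with
  | C c => simp
  | add p q hp hq => simp [hp, hq]
  | mul_X p l hp =>
    simp only [pderiv_mul, map_add, hp, pderiv_X, Pi.single_apply]
    split_ifs <;> simp <;> ring

/-- the operator `n - T ∂_T - X ∂_X` -/
noncomputable def eul (n : ℕ) (g : MvPolynomial (Fin 2) k) : MvPolynomial (Fin 2) k :=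
  (n : MvPolynomial (Fin 2) k) * g - X 0 * pderiv 0 g - X 1 * pderiv 1 g

theorem eul_hc (n : ℕ) {g : MvPolynomial (Fin 2) k} {m : ℕ} (h : g.totalDegree ≤ m) :
    eul n g = ∑ i ∈ Finset.range (m + 1), C ((n : k) - i) * homogeneousComponent i g := by
  conv_lhs => rw [← sum_hc_of_le g h]
  simp only [eul, map_sum, Finset.mul_sum, ← Finset.sum_sub_distrib]
  apply Finset.sum_congr rfl
  intro i _
  have := (homogeneousComponent_isHomogeneous i g).sum_X_mul_pderiv
  rw [Fin.sum_univ_two, nsmul_eq_mul] at this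
  rw [sub_sub, this]
  simp only [map_sub, map_natCast]
  ring

theorem totalDegree_eul {n : ℕ} {g : MvPolynomial (Fin 2) k} (h : g.totalDegree ≤ n) :
    (eul n g).totalDegree ≤ n - 1 := by
  rw [eul_hc n h, Finset.sum_range_succ, sub_self, C_0, zero_mul, add_zero]
  apply totalDegree_finsetSum_le
  intro i hi
  refine (totalDegree_mul _ _).trans ?_
  have := (homogeneousComponent_isHomogeneous i g).totalDegree_le
  simp at hi
  rw [totalDegree_C]
  omega

theorem hc_eul {n : ℕ} (hn : 1 ≤ n) {g : MvPolynomial (Fin 2) k} (h : g.totalDegree ≤ n) :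
    homogeneousComponent (n - 1) (eul n g) = homogeneousComponent (n - 1) g := by
  rw [eul_hc n h, map_sum, Finset.sum_eq_single (n - 1)]
  · rw [homogeneousComponent_C_mul,
      homogeneousComponent_eq_self (homogeneousComponent_isHomogeneous _ _)]
    rw [Nat.cast_sub hn]
    simp
  · intro i hi hne
    rw [homogeneousComponent_C_mul, homogeneousComponent_of_mem
      (homogeneousComponent_isHomogeneous i g), if_neg (Ne.symm hne), mul_zero]
  · intro h; simp at h

end HC

section NS
variable {k : Type*} [Field k] [IsAlgClosed k]

theorem isUnit_of_no_zero (ψ : MvPolynomial (Fin 2) k)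
    (h : ∀ v : Fin 2 → k, v ≠ 0 → eval v ψ ≠ 0) : IsUnit ψ := by
  have key : ∀ i, ∃ n, ψ ∣ X i ^ n := by
    intro i
    have : (X i : MvPolynomial (Fin 2) k) ∈ (Ideal.span {ψ}).radical := by
      rw [← vanishingIdeal_zeroLocus_eq_radical (K := k), mem_vanishingIdeal_iff]
      intro v hv
      rw [zeroLocus_span] at hv
      have hv' : eval v ψ = 0 := by simpa using hv
      by_cases hv0 : v = 0
      · simp [hv0]
      · exact absurd hv' (h v hv0)
    obtain ⟨n, hn⟩ := this
    exact ⟨n, Ideal.mem_span_singleton.mp hn⟩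
  obtain ⟨n, hn⟩ := key 0
  obtain ⟨m, hm⟩ := key 1
  have hrel : IsRelPrime (X 0 ^ n : MvPolynomial (Fin 2) k) (X 1 ^ m) := by
    apply IsRelPrime.pow
    have h0 : Irreducible (X 0 : MvPolynomial (Fin 2) k) := MvPolynomial.X_prime.irreducible
    rw [h0.isRelPrime_iff_not_dvd]
    rw [MvPolynomial.X_dvd_X]
    simp
  exact hrel hn hm

theorem bezout_of_no_zero (f g h : MvPolynomial (Fin 2) k)
    (hz : ∀ v : Fin 2 → k, eval v f = 0 → eval v g = 0 → eval v h = 0 → False) :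
    ∃ α β γ, α * g + β * h + γ * f = 1 := by
  have : Ideal.span {f, g, h} = ⊤ := by
    rw [← Ideal.radical_eq_top, ← vanishingIdeal_zeroLocus_eq_radical (K := k), Ideal.eq_top_iff_one,
      mem_vanishingIdeal_iff]
    intro v hv
    rw [zeroLocus_span] at hv
    exfalso
    have := fun p hp => (hv : ∀ p ∈ ({f, g, h} : Set (MvPolynomial (Fin 2) k)), aeval v p = 0) p hp
    exact hz v (this f (by simp)) (this g (by simp)) (this h (by simp))
  rw [Ideal.eq_top_iff_one, Ideal.mem_span_insert] at this
  obtain ⟨γ, z, hz, h1⟩ := this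
  rw [Ideal.mem_span_pair] at hz
  obtain ⟨α, β, rfl⟩ := hz
  exact ⟨α, β, γ, by rw [h1]; ring⟩

theorem degree_reduction {f : MvPolynomial (Fin 2) k} {d : ℕ} (hd : f.totalDegree = d)
    (hd1 : 1 ≤ d) (g u : Fin 3 → MvPolynomial (Fin 2) k) (hg : ∀ i, (g i).totalDegree ≤ d - 1)
    (hinf : ∀ v : Fin 2 → k, v ≠ 0 → eval v (homogeneousComponent d f) = 0 →
      ∃ i, eval v (homogeneousComponent (d - 1) (g i)) ≠ 0)
    (e : ℕ) (hu : ∀ i, (u i).totalDegree ≤ e + (d - 1)) (l : MvPolynomial (Fin 2) k)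
    (hl : ∀ i, f ∣ l * g i - u i) :
    ∃ l' : MvPolynomial (Fin 2) k, f ∣ l - l' ∧ l'.totalDegree ≤ e := by
  have hf0 : f ≠ 0 := by rintro rfl; simp at hd; omega
  have hφ0 : homogeneousComponent d f ≠ 0 := by
    intro h
    have := totalDegree_le_pred hd.le h
    omega
  induction hm : l.totalDegree using Nat.strong_induction_on generalizing l with
  | _ m ih =>
    by_cases hme : m ≤ e
    · exact ⟨l, by simp, by omega⟩
    push Not at hme
    set Λ := homogeneousComponent m l with hΛ
    set φ := homogeneousComponent d f with hφ
    have h1 : ∀ i, φ ∣ Λ * homogeneousComponent (d - 1) (g i) := by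
      intro i
      obtain ⟨q, hq⟩ := hl i
      have hqd : q.totalDegree ≤ m - 1 := by
        by_cases hq0 : q = 0
        · simp [hq0]
        have h2 := totalDegree_mul_of_isDomain hf0 hq0
        rw [← hq] at h2
        have h3 := totalDegree_sub (l * g i) (u i)
        have h4 := totalDegree_mul l (g i)
        have h5 := hg i
        have h6 := hu i
        have : (l * g i - u i).totalDegree ≤ m + (d - 1) := by
          refine h3.trans (max_le ?_ ?_) <;> omega
        omega
      refine ⟨homogeneousComponent (m - 1) q, ?_⟩
      rw [← hc_mul hm.le (hg i), ← hc_mul hd.le hqd, ← hq, map_sub]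
      have : m + (d - 1) = d + (m - 1) := by omega
      rw [← this, homogeneousComponent_eq_zero _ (u i) (by have := hu i; omega), sub_zero]
    have h2 : φ ∣ Λ := by
      obtain ⟨ψ, l', c, hrel, hc1, hc2⟩ :=
        UniqueFactorizationMonoid.exists_reduced_factors φ hφ0 Λ
      have hc0 : c ≠ 0 := by rintro rfl; simp at hc1; exact hφ0 hc1.symm
      have hψ : ∀ i, ψ ∣ homogeneousComponent (d - 1) (g i) := by
        intro i
        have := h1 i
        rw [← hc1, ← hc2, mul_assoc, mul_dvd_mul_iff_left hc0] at this
        exact hrel.dvd_of_dvd_mul_left this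
      have hu : IsUnit ψ := by
        apply isUnit_of_no_zero
        intro v hv h0
        obtain ⟨i, hi⟩ := hinf v hv (by rw [← hc1, map_mul, h0, mul_zero])
        obtain ⟨q, hq⟩ := hψ i
        exact hi (by rw [hq, map_mul, h0, zero_mul])
      rw [← hc1, ← hc2]
      exact mul_dvd_mul_left c (hu.dvd)
    obtain ⟨κ, hκ⟩ := h2
    have hΛ0 : Λ ≠ 0 := by
      intro h
      have := totalDegree_le_pred hm.le h
      omega
    have hκ0 : κ ≠ 0 := by rintro rfl; simp at hκ; exact hΛ0 hκ
    have hκd : d + κ.totalDegree = m := by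
      have h3 := totalDegree_mul_of_isDomain hφ0 hκ0
      rw [← hκ, (homogeneousComponent_isHomogeneous m l).totalDegree hΛ0,
        (homogeneousComponent_isHomogeneous d f).totalDegree hφ0] at h3
      exact h3.symm
    have hdeg : (l - f * κ).totalDegree ≤ m := by
      refine (totalDegree_sub _ _).trans (max_le hm.le ?_)
      refine (totalDegree_mul _ _).trans ?_
      omega
    have hdeg' : (l - f * κ).totalDegree ≤ m - 1 := by
      apply totalDegree_le_pred hdeg
      have e1 : homogeneousComponent m (f * κ) = φ * homogeneousComponent κ.totalDegree κ := by
        rw [← hκd, hc_mul hd.le le_rfl]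
      have e2 : Λ = φ * homogeneousComponent κ.totalDegree κ := by
        have : homogeneousComponent m Λ = Λ :=
          homogeneousComponent_eq_self (homogeneousComponent_isHomogeneous _ _)
        conv_lhs => rw [← this, hκ, ← hκd,
          hc_mul (homogeneousComponent_isHomogeneous d f).totalDegree_le le_rfl]
        rw [homogeneousComponent_eq_self (homogeneousComponent_isHomogeneous _ _)]
      rw [map_sub, e1, ← e2, sub_self]
    obtain ⟨l', hl1, hl2⟩ := ih _ (by omega) (l - f * κ) (fun i => by
      have : (l - f * κ) * g i - u i = (l * g i - u i) - f * (κ * g i) := by ring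
      rw [this]
      exact dvd_sub (hl i) (dvd_mul_right _ _)) rfl
    refine ⟨l', ?_, hl2⟩
    have : l - l' = (l - f * κ - l') + f * κ := by ring
    rw [this]
    exact dvd_add hl1 (dvd_mul_right _ _)

/-- The Hessian-type expression. -/
noncomputable def hess {k : Type*} [Field k] (f : MvPolynomial (Fin 2) k) : MvPolynomial (Fin 2) k :=
  pderiv 0 (pderiv 0 f) * pderiv 1 f ^ 2 - 2 * pderiv 0 (pderiv 1 f) * pderiv 0 f * pderiv 1 f
    + pderiv 1 (pderiv 1 f) * pderiv 0 f ^ 2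

theorem not_dvd_hess {f : MvPolynomial (Fin 2) k} {d : ℕ} (hd : f.totalDegree = d)
    (hd2 : 2 ≤ d) (hk : (d : k) ≠ 0) (hk1 : ((d - 1 : ℕ) : k) ≠ 0)
    (haff : ∀ v : Fin 2 → k, eval v f = 0 → eval v (pderiv 0 f) = 0 → eval v (pderiv 1 f) = 0 →
      False)
    (hinf : ∀ v : Fin 2 → k, v ≠ 0 → eval v (homogeneousComponent d f) = 0 →
      eval v (pderiv 0 (homogeneousComponent d f)) = 0 →
      eval v (pderiv 1 (homogeneousComponent d f)) = 0 →
      eval v (homogeneousComponent (d - 1) f) ≠ 0) :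
    ¬ f ∣ hess f := by
  rintro ⟨h, hh⟩
  obtain ⟨α, β, γ, hb⟩ := bezout_of_no_zero f _ _ haff
  have hf0 : f ≠ 0 := by rintro rfl; simp at hd; omega
  have hcomm : pderiv 1 (pderiv 0 f) = pderiv 0 (pderiv 1 f) := pderiv_pderiv_comm _ _ _
  set g : Fin 3 → MvPolynomial (Fin 2) k := ![pderiv 0 f, pderiv 1 f, eul d f] with hg
  set D : MvPolynomial (Fin 2) k → MvPolynomial (Fin 2) k :=
    fun g => pderiv 1 f * pderiv 0 g - pderiv 0 f * pderiv 1 g with hD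
  have hgd : ∀ i, (g i).totalDegree ≤ d - 1 := by
    intro i
    fin_cases i
    · exact hd ▸ totalDegree_pderiv_le 0 f
    · exact hd ▸ totalDegree_pderiv_le 1 f
    · exact totalDegree_eul hd.le
  have hginf : ∀ v : Fin 2 → k, v ≠ 0 → eval v (homogeneousComponent d f) = 0 →
      ∃ i, eval v (homogeneousComponent (d - 1) (g i)) ≠ 0 := by
    intro v hv h0
    by_contra! hcon
    have e : d - 1 + 1 = d := by omega
    have c0 : eval v (homogeneousComponent (d - 1) (pderiv 0 f)) = 0 := hcon 0
    have c1 : eval v (homogeneousComponent (d - 1) (pderiv 1 f)) = 0 := hcon 1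
    have c2 : eval v (homogeneousComponent (d - 1) (eul d f)) = 0 := hcon 2
    simp only [hc_pderiv, e] at c0 c1
    rw [hc_eul (by omega) hd.le] at c2
    exact hinf v hv h0 c0 c1 c2
  set l := α * D (pderiv 0 f) + β * D (pderiv 1 f) with hl
  have l0 : f ∣ l * pderiv 0 f - D (pderiv 0 f) := by
    refine ⟨-β * h - γ * D (pderiv 0 f), ?_⟩
    simp only [hl, hD, hess, hcomm] at hh ⊢
    linear_combination ((pderiv 1 f * pderiv 0 (pderiv 0 f) - pderiv 0 f * pderiv 0 (pderiv 1 f)))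
      * hb - β * hh
  have l1 : f ∣ l * pderiv 1 f - D (pderiv 1 f) := by
    refine ⟨α * h - γ * D (pderiv 1 f), ?_⟩
    simp only [hl, hD, hess, hcomm] at hh ⊢
    linear_combination ((pderiv 1 f * pderiv 0 (pderiv 1 f) - pderiv 0 f * pderiv 1 (pderiv 1 f)))
      * hb + α * hh
  have l2 : f ∣ l * eul d f - D (eul d f) := by
    obtain ⟨q0, hq0⟩ := l0
    obtain ⟨q1, hq1⟩ := l1
    refine ⟨(d : MvPolynomial (Fin 2) k) * l - X 0 * q0 - X 1 * q1, ?_⟩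
    have e : D (eul d f) = - X 0 * D (pderiv 0 f) - X 1 * D (pderiv 1 f) := by
      simp only [hD, eul, map_sub, pderiv_mul, pderiv_X_self, hcomm]
      rw [pderiv_X_of_ne (by decide), pderiv_X_of_ne (by decide)]
      simp only [Derivation.map_natCast]
      ring
    rw [e]
    simp only [eul]
    linear_combination (-X 0) * hq0 - X 1 * hq1
  have lg : ∀ i, f ∣ l * g i - D (g i) := by
    intro i; fin_cases i
    · exact l0
    · exact l1
    · exact l2
  have hfT : (pderiv 0 f).totalDegree ≤ d - 1 := hgd 0
  have hfX : (pderiv 1 f).totalDegree ≤ d - 1 := hgd 1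
  have hf2 : (eul d f).totalDegree ≤ d - 1 := hgd 2
  have hpd : ∀ i j, (pderiv j (g i)).totalDegree ≤ d - 2 := by
    intro i j
    have := totalDegree_pderiv_le j (g i)
    have := hgd i
    omega
  have bd : ∀ {a b c e : MvPolynomial (Fin 2) k}, a.totalDegree ≤ d - 1 → b.totalDegree ≤ d - 2 →
      c.totalDegree ≤ d - 1 → e.totalDegree ≤ d - 2 →
      (a * b - c * e).totalDegree ≤ (d - 2) + (d - 1) := by
    intro a b c e ha hb hc he
    refine (totalDegree_sub _ _).trans (max_le ?_ ?_)
    · refine (totalDegree_mul _ _).trans ?_; omega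
    · refine (totalDegree_mul _ _).trans ?_; omega
  obtain ⟨l', hl'1, hl'2⟩ := degree_reduction hd (by omega) g (fun i => D (g i)) hgd hginf (d - 2)
    (fun i => bd hfX (hpd i 0) hfT (hpd i 1)) l lg
  have lg' : ∀ i, f ∣ l' * g i - D (g i) := by
    intro i
    have : l' * g i - D (g i) = (l * g i - D (g i)) - (l - l') * g i := by ring
    rw [this]
    exact dvd_sub (lg i) (dvd_mul_of_dvd_left hl'1 _)
  have small : ∀ q : MvPolynomial (Fin 2) k, f ∣ q → q.totalDegree ≤ d - 1 → q = 0 := by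
    rintro q ⟨c, rfl⟩ hq
    by_contra hne
    have hc0 : c ≠ 0 := right_ne_zero_of_mul hne
    rw [totalDegree_mul_of_isDomain hf0 hc0] at hq
    omega
  have heu : ∀ i, (eul (d - 1) (g i)).totalDegree ≤ d - 2 := fun i => totalDegree_eul (hgd i)
  have hX : ∀ i : Fin 2, (X i : MvPolynomial (Fin 2) k).totalDegree = 1 := fun i => totalDegree_X i
  have hC : ((d - 1 : ℕ) : MvPolynomial (Fin 2) k).totalDegree = 0 := by
    rw [← map_natCast (C : k →+* MvPolynomial (Fin 2) k), totalDegree_C]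
  have main2 : (X 1 * l' + ((d - 1 : ℕ) : MvPolynomial (Fin 2) k) * pderiv 0 f).totalDegree ≤ d - 2 := by
    obtain ⟨m, hm1, hm2⟩ := degree_reduction hd (by omega) g
      (fun i => pderiv 0 f * eul (d - 1) (g i) - eul d f * pderiv 0 (g i)) hgd hginf (d - 2)
      (fun i => bd hfT (heu i) hf2 (hpd i 0)) (X 1 * l' + ((d - 1 : ℕ) : MvPolynomial (Fin 2) k) * pderiv 0 f) (fun i => by
        obtain ⟨q, hq⟩ := lg' i
        refine ⟨X 1 * q + (d : MvPolynomial (Fin 2) k) * pderiv 0 (g i), ?_⟩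
        simp only [hD, eul] at hq ⊢
        linear_combination X 1 * hq)
    have := small _ hm1 (by
      refine (totalDegree_sub _ _).trans (max_le ?_ (by omega))
      refine (totalDegree_add _ _).trans (max_le ?_ ?_)
      · refine (totalDegree_mul _ _).trans ?_; rw [hX]; omega
      · refine (totalDegree_mul _ _).trans ?_; rw [hC]; omega)
    rw [sub_eq_zero.mp this]
    exact hm2
  have main3 : (X 0 * l' - ((d - 1 : ℕ) : MvPolynomial (Fin 2) k) * pderiv 1 f).totalDegree ≤ d - 2 := by
    obtain ⟨m, hm1, hm2⟩ := degree_reduction hd (by omega) g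
      (fun i => eul d f * pderiv 1 (g i) - pderiv 1 f * eul (d - 1) (g i)) hgd hginf (d - 2)
      (fun i => bd hf2 (hpd i 1) hfX (heu i)) (X 0 * l' - ((d - 1 : ℕ) : MvPolynomial (Fin 2) k) * pderiv 1 f) (fun i => by
        obtain ⟨q, hq⟩ := lg' i
        refine ⟨X 0 * q - (d : MvPolynomial (Fin 2) k) * pderiv 1 (g i), ?_⟩
        simp only [hD, eul] at hq ⊢
        linear_combination X 0 * hq)
    have := small _ hm1 (by
      refine (totalDegree_sub _ _).trans (max_le ?_ (by omega))
      refine (totalDegree_sub _ _).trans (max_le ?_ ?_)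
      · refine (totalDegree_mul _ _).trans ?_; rw [hX]; omega
      · refine (totalDegree_mul _ _).trans ?_; rw [hC]; omega)
    rw [sub_eq_zero.mp this]
    exact hm2
  have key : C ((d - 1 : ℕ) * d : k) * f = C ((d - 1 : ℕ) : k) * eul d f +
      (X 0 * (X 1 * l' + ((d - 1 : ℕ) : MvPolynomial (Fin 2) k) * pderiv 0 f) -
        X 1 * (X 0 * l' - ((d - 1 : ℕ) : MvPolynomial (Fin 2) k) * pderiv 1 f)) := by
    simp only [eul, map_mul, map_natCast]
    ring
  have hlt : (C ((d - 1 : ℕ) * d : k) * f).totalDegree ≤ d - 1 := by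
    rw [key]
    refine (totalDegree_add _ _).trans (max_le ?_ ?_)
    · refine (totalDegree_mul _ _).trans ?_; rw [totalDegree_C]; omega
    · refine (totalDegree_sub _ _).trans (max_le ?_ ?_)
      · refine (totalDegree_mul _ _).trans ?_; rw [hX]; omega
      · refine (totalDegree_mul _ _).trans ?_; rw [hX]; omega
  have hCne : (C ((d - 1 : ℕ) * d : k) : MvPolynomial (Fin 2) k) ≠ 0 := by
    rw [Ne, C_eq_zero]; exact mul_ne_zero hk1 hk
  rw [totalDegree_mul_of_isDomain hCne hf0, totalDegree_C] at hlt
  omega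

end NS

section SM
variable {k : Type*} [Field k]

/-- substitution of a constant for the first of three variables -/
noncomputable def subst0 (a : k) : MvPolynomial (Fin 3) k →ₐ[k] MvPolynomial (Fin 2) k :=
  aeval ![C a, X 0, X 1]

theorem eval_subst0 (a : k) (v : Fin 2 → k) (F : MvPolynomial (Fin 3) k) :
    eval v (subst0 a F) = eval ![a, v 0, v 1] F := by
  induction F using MvPolynomial.induction_on with
  | C c => simp [subst0]
  | add p q hp hq => simp [hp, hq]
  | mul_X p l hp =>
    rw [map_mul, map_mul, hp, map_mul]
    congr 1
    fin_cases l <;> simp [subst0]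

theorem pderiv_subst0 (a : k) (i : Fin 2) (F : MvPolynomial (Fin 3) k) :
    pderiv i (subst0 a F) = subst0 a (pderiv i.succ F) := by
  induction F using MvPolynomial.induction_on with
  | C c => simp [subst0]
  | add p q hp hq => simp [hp, hq]
  | mul_X p l hp =>
    rw [map_mul, pderiv_mul, pderiv_mul, hp, map_add, map_mul, map_mul]
    congr 2
    fin_cases l <;> fin_cases i <;> simp [subst0, pderiv_X]

theorem subst0_monomial (a c : k) (m : Fin 3 →₀ ℕ) :
    subst0 a (monomial m c) = C (c * a ^ m 0) * (X 0 ^ m 1 * X 1 ^ m 2) := by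
  rw [subst0, aeval_monomial, Finsupp.prod_fintype _ _ (by simp)]
  simp [Fin.prod_univ_three, algebraMap_eq, mul_assoc]

theorem isHomogeneous_XX (m n : ℕ) :
    (X 0 ^ m * X 1 ^ n : MvPolynomial (Fin 2) k).IsHomogeneous (m + n) := by
  have h := ((isHomogeneous_X k (0 : Fin 2)).pow m).mul ((isHomogeneous_X k (1 : Fin 2)).pow n)
  simpa using h

theorem hc_subst0 {F : MvPolynomial (Fin 3) k} {d : ℕ} (hF : F.IsHomogeneous d) :
    homogeneousComponent d (subst0 1 F) = subst0 0 F := by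
  conv_lhs => rw [F.as_sum, map_sum, map_sum]
  conv_rhs => rw [F.as_sum, map_sum]
  apply Finset.sum_congr rfl
  intro m hm
  have hmd : m 0 + m 1 + m 2 = d := by
    have := hF (mem_support_iff.mp hm)
    rw [Finsupp.weight_apply, Finsupp.sum_fintype _ _ (by simp), Fin.sum_univ_three] at this
    simpa using this
  rw [subst0_monomial, subst0_monomial, homogeneousComponent_C_mul,
    homogeneousComponent_of_mem (isHomogeneous_XX _ _)]
  by_cases h0 : m 0 = 0
  · rw [if_pos (by omega), h0]; simp
  · rw [if_neg (by omega)]; simp [h0]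

theorem hc_pred_subst0 {F : MvPolynomial (Fin 3) k} {d : ℕ} (hd : 1 ≤ d) (hF : F.IsHomogeneous d) :
    homogeneousComponent (d - 1) (subst0 1 F) = subst0 0 (pderiv 0 F) := by
  conv_lhs => rw [F.as_sum, map_sum, map_sum]
  conv_rhs => rw [F.as_sum, map_sum, map_sum]
  apply Finset.sum_congr rfl
  intro m hm
  have hmd : m 0 + m 1 + m 2 = d := by
    have := hF (mem_support_iff.mp hm)
    rw [Finsupp.weight_apply, Finsupp.sum_fintype _ _ (by simp), Fin.sum_univ_three] at this
    simpa using this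
  rw [subst0_monomial, pderiv_monomial, subst0_monomial, homogeneousComponent_C_mul,
    homogeneousComponent_of_mem (isHomogeneous_XX _ _)]
  by_cases h0 : m 0 = 1
  · rw [if_pos (by omega)]; simp [h0]
  · rw [if_neg (by omega)]
    by_cases h1 : m 0 = 0
    · simp [h1]
    · have : m 0 - 1 ≠ 0 := by omega
      simp [this]

theorem smooth_aff {F : MvPolynomial (Fin 3) k} {d : ℕ} (hF : F.IsHomogeneous d)
    (hs : ∀ x : Fin 3 → k, x ≠ 0 → eval x F = 0 → ∃ j, eval x (pderiv j F) ≠ 0)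
    (v : Fin 2 → k) (h0 : eval v (subst0 1 F) = 0) (h1 : eval v (pderiv 0 (subst0 1 F)) = 0)
    (h2 : eval v (pderiv 1 (subst0 1 F)) = 0) : False := by
  rw [pderiv_subst0, eval_subst0] at h1 h2
  rw [eval_subst0] at h0
  have he := congrArg (eval ![1, v 0, v 1]) hF.sum_X_mul_pderiv
  rw [Fin.sum_univ_three] at he
  simp only [map_add, map_mul, map_nsmul, h0, smul_zero] at he
  have h1' : eval ![1, v 0, v 1] (pderiv 1 F) = 0 := h1
  have h2' : eval ![1, v 0, v 1] (pderiv 2 F) = 0 := h2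
  rw [h1', h2'] at he
  obtain ⟨j, hj⟩ := hs ![1, v 0, v 1] (fun h => by simpa using congrFun h 0) h0
  fin_cases j
  · exact hj (by simpa using he)
  · exact hj h1'
  · exact hj h2'

theorem smooth_inf {F : MvPolynomial (Fin 3) k} {d : ℕ} (hd : 1 ≤ d) (hF : F.IsHomogeneous d)
    (hs : ∀ x : Fin 3 → k, x ≠ 0 → eval x F = 0 → ∃ j, eval x (pderiv j F) ≠ 0)
    (v : Fin 2 → k) (hv : v ≠ 0) (h0 : eval v (homogeneousComponent d (subst0 1 F)) = 0)
    (h1 : eval v (pderiv 0 (homogeneousComponent d (subst0 1 F))) = 0)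
    (h2 : eval v (pderiv 1 (homogeneousComponent d (subst0 1 F))) = 0) :
    eval v (homogeneousComponent (d - 1) (subst0 1 F)) ≠ 0 := by
  rw [hc_subst0 hF, pderiv_subst0, eval_subst0] at h1 h2
  rw [hc_subst0 hF, eval_subst0] at h0
  rw [hc_pred_subst0 hd hF, eval_subst0]
  intro h3
  obtain ⟨j, hj⟩ := hs ![0, v 0, v 1] (fun h => hv (by
    ext i; fin_cases i
    · simpa using congrFun h 1
    · simpa using congrFun h 2)) h0
  fin_cases j
  · exact hj h3
  · exact hj h1
  · exact hj h2

/-- The consequences of the smoothness hypotheses. -/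
theorem smooth_consequences [IsAlgClosed k] {F : MvPolynomial (Fin 3) k} {d : ℕ} (hd : 2 ≤ d)
    (hF : F.IsHomogeneous d)
    (hs : ∀ x : Fin 3 → k, x ≠ 0 → eval x F = 0 → ∃ j, eval x (pderiv j F) ≠ 0)
    {f : MvPolynomial (Fin 2) k} (hf : subst0 1 F = f) (hfd : f.totalDegree = d)
    (hk : (d : k) ≠ 0) (hk1 : ((d - 1 : ℕ) : k) ≠ 0) :
    (∀ v : Fin 2 → k, eval v f = 0 → eval v (pderiv 0 f) = 0 → eval v (pderiv 1 f) = 0 → False) ∧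
      ¬ f ∣ hess f := by
  subst hf
  exact ⟨smooth_aff hF hs, not_dvd_hess hfd hd hk hk1 (smooth_aff hF hs)
    (smooth_inf (by omega) hF hs)⟩
end SM

section Dep
variable {k E : Type*} [Field k] [Field E] [Algebra k E]

theorem ne_of_algInd {t x : E} (h : AlgebraicIndependent k ![t, x]) : t ≠ x := by
  intro e
  have := h.injective (a₁ := 0) (a₂ := 1) (by simpa using e)
  simp at this

theorem range_pair {α : Type*} (t x : α) : Set.range ![t, x] = {t, x} := by
  simp [Matrix.range_cons, Matrix.range_empty, Set.pair_comm]

theorem matroid_indep_pair {t x : E} (hne : t ≠ x) :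
    (AlgebraicIndependent.matroid k E).Indep {t, x} ↔ AlgebraicIndependent k ![t, x] := by
  have hinj : Function.Injective ![t, x] := by
    intro i j hij
    fin_cases i <;> fin_cases j <;> simp_all
  rw [← algebraicIndependent_subtype_range hinj, range_pair]
  exact Iff.rfl

theorem dep2 {t x A B : E} (hdep : ¬ AlgebraicIndependent k ![t, x])
    (hA : IsAlgebraic (Algebra.adjoin k {t, x}) A)
    (hB : IsAlgebraic (Algebra.adjoin k {t, x}) B) : ¬ AlgebraicIndependent k ![A, B] := by
  intro h
  have hne := ne_of_algInd h
  rw [← matroid_indep_pair hne] at h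
  set M := AlgebraicIndependent.matroid k E
  have hsub : ({A, B} : Set E) ⊆ M.closure {t, x} := by
    rw [AlgebraicIndependent.matroid_closure_eq]
    rintro y (rfl | rfl)
    · exact hA
    · exact hB
  have h1 := h.encard_le_eRk_of_subset hsub
  rw [M.eRk_closure_eq, Set.encard_pair hne] at h1
  rw [show (2 : ℕ∞) = ((2 : ℕ) : ℕ∞) from rfl, Matroid.le_eRk_iff] at h1
  obtain ⟨I, hI, hind, hc⟩ := h1
  have htx : t ≠ x := by
    rintro rfl
    have := Set.encard_le_encard hI
    rw [hc] at this
    simp at this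
  have : I = {t, x} := by
    apply Set.Finite.eq_of_subset_of_encard_le ((Set.toFinite {t, x}).subset hI) hI
    rw [hc, Set.encard_pair htx]; rfl
  rw [this, matroid_indep_pair htx] at hind
  exact hdep hind

theorem not_algInd_of_zero {t x : E} {f : MvPolynomial (Fin 2) k} (hf : f ≠ 0)
    (h : aeval ![t, x] f = 0) : ¬ AlgebraicIndependent k ![t, x] := by
  intro hi
  rw [algebraicIndependent_iff] at hi
  exact hf (hi f h)

theorem aeval_mem_adjoin (t x : E) (g : MvPolynomial (Fin 2) k) :
    aeval ![t, x] g ∈ Algebra.adjoin k {t, x} := by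
  rw [← range_pair t x, Algebra.adjoin_range_eq_range_aeval]
  exact ⟨g, rfl⟩

theorem isAlgebraic_of_mem {s : Set E} {y : E} (h : y ∈ Algebra.adjoin k s) :
    IsAlgebraic (Algebra.adjoin k s) y :=
  isAlgebraic_algebraMap (⟨y, h⟩ : Algebra.adjoin k s)

/-- Tr lemma -/
theorem tr_lemma {s x A B : E} {f : MvPolynomial (Fin 2) k} (hf : f ≠ 0)
    (h : aeval ![s, x] f = 0) (hx : x = A * s + B) (hi : AlgebraicIndependent k ![A, B]) :
    ¬ IsAlgebraic (Algebra.adjoin k {s, x}) A := by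
  intro hA
  refine dep2 (not_algInd_of_zero hf h) hA ?_ hi
  have : B = x - A * s := by rw [hx]; ring
  rw [this]
  have hx' : IsAlgebraic (Algebra.adjoin k {s, x}) x :=
    isAlgebraic_of_mem (Algebra.subset_adjoin (by simp))
  have hs' : IsAlgebraic (Algebra.adjoin k {s, x}) s :=
    isAlgebraic_of_mem (Algebra.subset_adjoin (by simp))
  exact hx'.sub (hA.mul hs')

theorem isAlgebraic_of_mul {s x A : E} {g h : MvPolynomial (Fin 2) k}
    (h0 : A * aeval ![s, x] g = aeval ![s, x] h) (hg : aeval ![s, x] g ≠ 0) :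
    IsAlgebraic (Algebra.adjoin k {s, x}) A := by
  have : A = aeval ![s, x] h * (aeval ![s, x] g)⁻¹ := by rw [← h0]; field_simp
  rw [this]
  exact (isAlgebraic_of_mem (aeval_mem_adjoin _ _ _)).mul
    (isAlgebraic_of_mem (aeval_mem_adjoin _ _ _)).inv

theorem totalDegree_pow_dom {H : MvPolynomial (Fin 2) k} (h : H ≠ 0) (p : ℕ) :
    (H ^ p).totalDegree = p * H.totalDegree := by
  induction p with
  | zero => simp
  | succ n ih => rw [pow_succ, totalDegree_mul_of_isDomain (pow_ne_zero _ h) h, ih]; ring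

theorem exists_nonsingular_rel [PerfectField k] {a b : E} (h : ¬ AlgebraicIndependent k ![a, b]) :
    ∃ G : MvPolynomial (Fin 2) k, aeval ![a, b] G = 0 ∧
      (aeval ![a, b] (pderiv 0 G) ≠ 0 ∨ aeval ![a, b] (pderiv 1 G) ≠ 0) := by
  have key : ∀ n, ∀ G : MvPolynomial (Fin 2) k, G ≠ 0 → aeval ![a, b] G = 0 → G.totalDegree = n →
    ∃ G : MvPolynomial (Fin 2) k, aeval ![a, b] G = 0 ∧
      (aeval ![a, b] (pderiv 0 G) ≠ 0 ∨ aeval ![a, b] (pderiv 1 G) ≠ 0) := by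
    intro n
    induction n using Nat.strong_induction_on with
    | _ n ih =>
      intro G hG0 hG hn
      have hn0 : n ≠ 0 := by
        rintro rfl
        rw [totalDegree_eq_zero_iff_eq_C] at hn
        rw [hn, aeval_C, map_eq_zero] at hG
        rw [hG, C_0] at hn
        exact hG0 hn
      by_cases h0 : aeval ![a, b] (pderiv 0 G) = 0
      swap
      · exact ⟨G, hG, Or.inl h0⟩
      by_cases h1 : aeval ![a, b] (pderiv 1 G) = 0
      swap
      · exact ⟨G, hG, Or.inr h1⟩
      by_cases z0 : pderiv 0 G = 0
      swap
      · refine ih _ ?_ _ z0 h0 rfl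
        have := totalDegree_pderiv_le 0 G
        omega
      by_cases z1 : pderiv 1 G = 0
      swap
      · refine ih _ ?_ _ z1 h1 rfl
        have := totalDegree_pderiv_le 1 G
        omega
      have z : ∀ i, pderiv i G = 0 := by intro i; fin_cases i <;> assumption
      have hexp : ∀ m, G.coeff m ≠ 0 → ∀ i, ((m i : ℕ) : k) = 0 := by
        intro m hm i
        by_cases hmi : m i = 0
        · simp [hmi]
        have := congrArg (coeff (m - Finsupp.single i 1)) (z i)
        rw [coeff_pderiv, coeff_zero] at this
        have e : m - Finsupp.single i 1 + Finsupp.single i 1 = m := by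
          apply tsub_add_cancel_of_le
          rw [Finsupp.single_le_iff]; omega
        rw [e] at this
        have h2 := (mul_eq_zero.mp this).resolve_left hm
        have e2 : (m - Finsupp.single i 1 : Fin 2 →₀ ℕ) i + 1 = m i := by simp; omega
        rw [← e2]
        push_cast
        exact h2
      obtain ⟨p, hp⟩ := CharP.exists k
      rcases CharP.char_is_prime_or_zero k p with hpp | rfl
      · have : Fact p.Prime := ⟨hpp⟩
        have : ExpChar k p := ExpChar.prime hpp
        have hdvd : ∀ m, G.coeff m ≠ 0 → ∀ i, p ∣ m i := fun m hm i =>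
          (CharP.cast_eq_zero_iff k p _).mp (hexp m hm i)
        let H : MvPolynomial (Fin 2) k := ∑ m ∈ G.support,
          monomial (m.mapRange (· / p) (by simp)) ((frobeniusEquiv k p).symm (G.coeff m))
        have hH : H ^ p = G := by
          rw [sum_pow_char]
          conv_rhs => rw [G.as_sum]
          apply Finset.sum_congr rfl
          intro m hm
          rw [monomial_pow]
          congr 1
          · congr 1
            ext i
            simpa using Nat.mul_div_cancel' (hdvd m (mem_support_iff.mp hm) i)
          · exact frobeniusEquiv_symm_pow_p ..
        have hH0 : H ≠ 0 := by
          intro h; rw [h, zero_pow hpp.ne_zero] at hH; exact hG0 hH.symm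
        refine ih H.totalDegree ?_ H hH0 ?_ rfl
        · have := congrArg totalDegree hH
          rw [totalDegree_pow_dom hH0, hn] at this
          rcases Nat.eq_zero_or_pos H.totalDegree with h0 | h0
          · omega
          · rw [← this]
            have := hpp.two_le
            nlinarith
        · rw [← hH, map_pow] at hG
          exact eq_zero_of_pow_eq_zero hG
      · exfalso
        apply hn0
        rw [← hn, totalDegree_eq_zero_iff_eq_C]
        ext m
        rw [coeff_C]
        split_ifs with hm
        · rw [hm]
        · by_contra hc
          apply hm
          ext i
          have := hexp m hc i
          rw [CharP.cast_eq_zero_iff k 0] at this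
          simpa using (Nat.eq_zero_of_zero_dvd this).symm
  rw [algebraicIndependent_iff] at h
  push Not at h
  obtain ⟨G, hG, hG0⟩ := h
  exact key _ G hG0 hG rfl

end Dep

/-- The properties of the plane curves which are used in the proof. -/
structure GoodCurve {k : Type*} [Field k] (f : MvPolynomial (Fin 2) k) : Prop where
  irr : Irreducible f
  aff : ∀ v : Fin 2 → k, eval v f = 0 → eval v (pderiv 0 f) = 0 → eval v (pderiv 1 f) = 0 → False
  hess : ¬ f ∣ hess f

section Tan
variable {k E : Type*} [Field k] [Field E] [Algebra k E]

/-- `(t, x)` is a generic point of `f = 0`. -/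
structure GenericPt (f : MvPolynomial (Fin 2) k) (t x : E) : Prop where
  zero : aeval ![t, x] f = 0
  gen : ¬ (IsAlgebraic k t ∧ IsAlgebraic k x)

variable {f : MvPolynomial (Fin 2) k}

theorem mem_range_of_isAlgebraic [IsAlgClosed k] {t : E} (h : IsAlgebraic k t) :
    ∃ c, algebraMap k E c = t :=
  minpoly.mem_range_of_degree_eq_one k t
    (IsAlgClosed.degree_eq_one_of_irreducible k (minpoly.irreducible h.isIntegral))

theorem GoodCurve.hess_ne (hf : GoodCurve f) {t x : E} (h : GenericPt f t x) :
    aeval ![t, x] (_root_.hess f) ≠ 0 := by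
  rw [Ne, generic_dvd hf.irr h.zero h.gen]
  exact hf.hess

theorem GoodCurve.fX_ne (hf : GoodCurve f) {t x : E} (h : GenericPt f t x) :
    aeval ![t, x] (pderiv 1 f) ≠ 0 := by
  intro h0
  obtain ⟨q, hq⟩ := (generic_dvd hf.irr h.zero h.gen _).mp h0
  apply hf.hess_ne h
  have h1 : pderiv 1 (pderiv 1 f) = pderiv 1 f * q + f * pderiv 1 q := by
    conv_lhs => rw [hq, pderiv_mul]
  have h1' := congrArg (aeval ![t, x]) h1
  simp only [map_add, map_mul, h0, h.zero, zero_mul, add_zero] at h1'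
  simp only [_root_.hess, map_add, map_sub, map_mul, map_pow, h0, h1']
  ring

theorem GoodCurve.slope_transc (hf : GoodCurve f) {t x a : E} (h : GenericPt f t x)
    (ha : aeval ![t, x] (pderiv 0 f) + a * aeval ![t, x] (pderiv 1 f) = 0) (c : k) :
    a ≠ algebraMap k E c := by
  rintro rfl
  have h0 : aeval ![t, x] (pderiv 0 f + C c * pderiv 1 f) = 0 := by
    simpa using ha
  obtain ⟨q, hq⟩ := (generic_dvd hf.irr h.zero h.gen _).mp h0
  apply hf.hess_ne h
  have h1 := congrArg (fun g => aeval ![t, x] (pderiv 0 g)) hq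
  have h2 := congrArg (fun g => aeval ![t, x] (pderiv 1 g)) hq
  simp only [pderiv_mul, map_add, map_mul, pderiv_C, h.zero, zero_mul, add_zero, zero_add,
    aeval_C, map_zero, pderiv_pderiv_comm 1 0 f] at h1 h2
  simp only [_root_.hess, map_add, map_sub, map_mul, map_pow, map_ofNat]
  have hT : aeval ![t, x] (pderiv 0 f) = - algebraMap k E c * aeval ![t, x] (pderiv 1 f) := by
    linear_combination ha
  rw [hT] at h1 ⊢
  linear_combination aeval ![t, x] (pderiv 1 f) ^ 2 * (h1 + algebraMap k E c * h2)

theorem GoodCurve.second_ne (hf : GoodCurve f) {t x a : E} (h : GenericPt f t x)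
    (ha : aeval ![t, x] (pderiv 0 f) + a * aeval ![t, x] (pderiv 1 f) = 0) :
    aeval ![t, x] (pderiv 0 (pderiv 0 f)) + 2 * a * aeval ![t, x] (pderiv 0 (pderiv 1 f))
      + a ^ 2 * aeval ![t, x] (pderiv 1 (pderiv 1 f)) ≠ 0 := by
  intro h0
  apply hf.hess_ne h
  simp only [_root_.hess, map_add, map_sub, map_mul, map_pow, map_ofNat]
  have hT : aeval ![t, x] (pderiv 0 f) = - a * aeval ![t, x] (pderiv 1 f) := by
    linear_combination ha
  rw [hT]
  linear_combination aeval ![t, x] (pderiv 1 f) ^ 2 * h0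

theorem GoodCurve.generic_of_tangent [IsAlgClosed k] (hf : GoodCurve f) {t x a : E}
    (h0 : aeval ![t, x] f = 0)
    (ha : aeval ![t, x] (pderiv 0 f) + a * aeval ![t, x] (pderiv 1 f) = 0)
    (hat : ∀ c, a ≠ algebraMap k E c) : GenericPt f t x := by
  refine ⟨h0, ?_⟩
  rintro ⟨ht, hx⟩
  obtain ⟨t, rfl⟩ := mem_range_of_isAlgebraic ht
  obtain ⟨x, rfl⟩ := mem_range_of_isAlgebraic hx
  have ev : ∀ g : MvPolynomial (Fin 2) k, aeval ![algebraMap k E t, algebraMap k E x] g =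
      algebraMap k E (eval ![t, x] g) := by
    intro g
    have := aeval_pair_map (Algebra.ofId k E) t x g
    simp only [Algebra.ofId_apply] at this
    rw [← this]; rfl
  rw [ev] at h0
  rw [ev, ev] at ha
  have h0' : eval ![t, x] f = 0 := by simpa using h0
  have h2 : eval ![t, x] (pderiv 1 f) = 0 := by
    by_contra hne
    apply hat (- eval ![t, x] (pderiv 0 f) / eval ![t, x] (pderiv 1 f))
    have hne' : algebraMap k E (eval ![t, x] (pderiv 1 f)) ≠ 0 := by simpa using hne
    rw [map_div₀, map_neg, eq_div_iff hne']
    linear_combination ha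
  rw [h2, map_zero, mul_zero, add_zero, map_eq_zero] at ha
  exact hf.aff _ h0' ha h2

theorem clear_denom (f G : MvPolynomial (Fin 2) k) : ∃ (N : ℕ) (H : MvPolynomial (Fin 2) k),
    ∀ (R : Type*) [CommRing R] [Algebra k R] (t x a : R),
      aeval ![t, x] (pderiv 0 f) + a * aeval ![t, x] (pderiv 1 f) = 0 →
      aeval ![t, x] (pderiv 1 f) ^ N * aeval ![a, x - a * t] G = aeval ![t, x] H := by
  induction G using MvPolynomial.induction_on with
  | C c => exact ⟨0, C c, fun R _ _ t x a _ => by simp⟩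
  | add p q hp hq =>
    obtain ⟨N, H, h⟩ := hp
    obtain ⟨N', H', h'⟩ := hq
    refine ⟨N + N', pderiv 1 f ^ N' * H + pderiv 1 f ^ N * H', fun R _ _ t x a ha => ?_⟩
    simp only [map_add, map_mul, map_pow, ← h R t x a ha, ← h' R t x a ha]
    ring
  | mul_X p l hp =>
    obtain ⟨N, H, h⟩ := hp
    refine ⟨N + 1, if l = 0 then - H * pderiv 0 f else H * (X 1 * pderiv 1 f + X 0 * pderiv 0 f),
      fun R _ _ t x a ha => ?_⟩
    have hT : aeval ![t, x] (pderiv 0 f) = - a * aeval ![t, x] (pderiv 1 f) := by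
      linear_combination ha
    fin_cases l
    · simp [← h R t x a ha, hT]
      ring
    · simp [← h R t x a ha, hT]
      ring

theorem GoodCurve.dual (hf : GoodCurve f) {t x a : E} (h : GenericPt f t x)
    (ha : aeval ![t, x] (pderiv 0 f) + a * aeval ![t, x] (pderiv 1 f) = 0)
    (G : MvPolynomial (Fin 2) k) (hG : aeval ![a, x - a * t] G = 0) :
    aeval ![a, x - a * t] (pderiv 0 G) = t * aeval ![a, x - a * t] (pderiv 1 G) := by
  obtain ⟨N, H, hH⟩ := clear_denom f G
  have hHd : f ∣ H := by
    rw [← generic_dvd hf.irr h.zero h.gen, ← hH E t x a ha, hG, mul_zero]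
  let ι : E →ₐ[k] DualNumber E := TrivSqZeroExt.inlAlgHom k E E
  let ε : DualNumber E := DualNumber.eps
  have hε : ε ^ 2 = 0 := by rw [pow_two]; exact DualNumber.eps_mul_eps
  have hεinj : ∀ e : E, ε * ι e = 0 → e = 0 := by
    intro e he
    have := congrArg TrivSqZeroExt.snd he
    simpa [ε, ι] using this
  set fT := aeval ![t, x] (pderiv 0 f) with hfT
  set fX := aeval ![t, x] (pderiv 1 f) with hfX
  have hfX0 : fX ≠ 0 := hf.fX_ne h
  set fTT := aeval ![t, x] (pderiv 0 (pderiv 0 f)) with hfTT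
  set fTX := aeval ![t, x] (pderiv 0 (pderiv 1 f)) with hfTX
  set fXX := aeval ![t, x] (pderiv 1 (pderiv 1 f)) with hfXX
  have hs := hf.second_ne h ha
  rw [← hfTT, ← hfTX, ← hfXX] at hs
  set a' : E := -(fTT + 2 * a * fTX + a ^ 2 * fXX) with ha'
  have ev : ∀ g : MvPolynomial (Fin 2) k, aeval ![ι t + ε * ι fX, ι x + ε * ι (-fT)] g =
      ι (aeval ![t, x] g) + ε * ι (fX * aeval ![t, x] (pderiv 0 g) - fT * aeval ![t, x] (pderiv 1 g)) := by
    intro g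
    obtain ⟨e, he⟩ := taylor2 (R := DualNumber E) g (ι t) (ι x) (ι fX) (ι (-fT)) ε
    rw [he, hε, ← aeval_pair_map, ← aeval_pair_map, ← aeval_pair_map]
    simp only [map_sub, map_mul, map_neg]
    ring
  have hT : fT = - a * fX := by linear_combination ha
  have htan : aeval ![ι t + ε * ι fX, ι x + ε * ι (-fT)] (pderiv 0 f) +
      (ι a + ε * ι a') * aeval ![ι t + ε * ι fX, ι x + ε * ι (-fT)] (pderiv 1 f) = 0 := by
    rw [ev, ev, pderiv_pderiv_comm 1 0, ← hfT, ← hfX, ← hfTT, ← hfTX, ← hfXX, hT, ha']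
    simp only [map_sub, map_mul, map_neg, map_add, map_pow, map_ofNat]
    linear_combination (-(ι fTT + 2 * ι a * ι fTX + ι a ^ 2 * ι fXX) *
      (ι fX * ι fTX + ι a * ι fX * ι fXX)) * hε
  have h1 := hH (DualNumber E) _ _ _ htan
  have h2 : aeval ![ι t + ε * ι fX, ι x + ε * ι (-fT)] H = 0 := by
    obtain ⟨q, rfl⟩ := hHd
    rw [map_mul, ev f, h.zero, ← hfT, ← hfX, mul_comm fX fT, sub_self]
    simp
  rw [h2] at h1
  have hu : IsUnit (aeval ![ι t + ε * ι fX, ι x + ε * ι (-fT)] (pderiv 1 f)) := by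
    rw [ev, TrivSqZeroExt.isUnit_iff_isUnit_fst]
    simpa [ε, ι] using hfX0
  rw [(hu.pow N).mul_right_eq_zero] at h1
  obtain ⟨e, he⟩ := taylor2 (R := DualNumber E) G (ι a) (ι (x - a * t)) (ι a') (ι (-a' * t)) ε
  have e1 : ι x + ε * ι (-fT) - (ι a + ε * ι a') * (ι t + ε * ι fX) =
      ι (x - a * t) + ε * ι (-a' * t) := by
    rw [hT]
    simp only [map_sub, map_mul, map_neg]
    linear_combination (- ι a' * ι fX) * hε
  rw [e1, he, ← aeval_pair_map, ← aeval_pair_map, ← aeval_pair_map, hG, hε, map_zero, zero_mul,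
    add_zero, zero_add, ← map_mul, ← map_mul, ← map_add] at h1
  have h3 := hεinj _ h1
  have h4 : a' * (aeval ![a, x - a * t] (pderiv 0 G) - t * aeval ![a, x - a * t] (pderiv 1 G)) = 0 := by
    linear_combination h3
  have h5 := (mul_eq_zero.mp h4).resolve_left (neg_ne_zero.mpr hs)
  linear_combination h5

theorem GoodCurve.tangent_dep (hf : GoodCurve f) {t x a : E} (h : GenericPt f t x)
    (ha : aeval ![t, x] (pderiv 0 f) + a * aeval ![t, x] (pderiv 1 f) = 0) :
    ¬ AlgebraicIndependent k ![a, x - a * t] := by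
  intro hi
  refine tr_lemma hf.irr.ne_zero h.zero (by ring) hi ?_
  apply isAlgebraic_of_mul (g := pderiv 1 f) (h := - pderiv 0 f) _ (hf.fX_ne h)
  rw [map_neg]
  linear_combination ha

/-- no bitangents at the generic point -/
theorem no_bitangent [IsAlgClosed k] {f g : MvPolynomial (Fin 2) k} (hf : GoodCurve f)
    (hg : GoodCurve g) {t x a t' : E} (h : GenericPt f t x)
    (ha : aeval ![t, x] (pderiv 0 f) + a * aeval ![t, x] (pderiv 1 f) = 0)
    (hz : aeval ![t', a * t' + (x - a * t)] g = 0)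
    (ha' : aeval ![t', a * t' + (x - a * t)] (pderiv 0 g) +
      a * aeval ![t', a * t' + (x - a * t)] (pderiv 1 g) = 0) :
    t' = t ∧ f ∣ g := by
  have hgen := hg.generic_of_tangent hz ha' (hf.slope_transc h ha)
  obtain ⟨G, hG, hG'⟩ := exists_nonsingular_rel (hf.tangent_dep h ha)
  have e1 := hf.dual h ha G hG
  have hb : a * t' + (x - a * t) - a * t' = x - a * t := by ring
  have e2 := hg.dual hgen ha' G (by rw [hb]; exact hG)
  rw [hb] at e2
  have hB : aeval ![a, x - a * t] (pderiv 1 G) ≠ 0 := by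
    intro h0
    rw [h0, mul_zero] at e1
    exact hG'.elim (fun h => h e1) (fun h => h h0)
  have ht : t' = t := mul_right_cancel₀ hB (e2.symm.trans e1)
  refine ⟨ht, ?_⟩
  subst ht
  rw [← generic_dvd hf.irr h.zero h.gen]
  simpa using hz

end Tan

theorem isAlgebraic_of_subset {k k1 E : Type*} [Field k] [Field k1] [Field E] [Algebra k E]
    [Algebra k1 E] (L : IntermediateField k E) (L1 : IntermediateField k1 E)
    (h : ∀ z ∈ L, z ∈ L1) (y : E) (hy : IsAlgebraic L y) : IsAlgebraic L1 y := by
  obtain ⟨p, hp, hpy⟩ := hy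
  let ι : L →+* L1 := (algebraMap L E).codRestrict L1 (fun z => h z z.2)
  refine ⟨p.map ι, ?_, ?_⟩
  · rw [Ne, Polynomial.map_eq_zero_iff ι.injective]; exact hp
  · rw [Polynomial.aeval_def, Polynomial.eval₂_map]
    exact hpy

theorem extend_equiv0 {L L' E : Type*} [Field L] [Field L'] [Field E] [Algebra L E] [Algebra L' E]
    [IsAlgClosed E]
    (h : ∀ y : E, IsAlgebraic L y) (h' : ∀ y : E, IsAlgebraic L' y)
    (e : L ≃+* L') : ∃ σ : E ≃+* E, ∀ z : L, σ (algebraMap L E z) = algebraMap L' E (e z) := by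
  have : IsAlgClosure L E := ⟨inferInstance, ⟨h⟩⟩
  have : IsAlgClosure L' E := ⟨inferInstance, ⟨h'⟩⟩
  exact ⟨IsAlgClosure.equivOfEquiv E E e, fun z => IsAlgClosure.equivOfEquiv_algebraMap E E e z⟩

theorem extend_equiv {k E : Type*} [Field k] [Field E] [Algebra k E] [IsAlgClosed E]
    (L L' : IntermediateField k E) (h : ∀ y : E, IsAlgebraic L y) (h' : ∀ y : E, IsAlgebraic L' y)
    (e : L ≃+* L') : ∃ σ : E ≃+* E, ∀ z : L, σ z = e z :=
  extend_equiv0 h h' e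

section Aut
universe u
variable {k : Type u} {E : Type*} [Field k] [Field E] [Algebra k E] [IsAlgClosed E]

theorem exists_hom {g : MvPolynomial (Fin 2) k} (hg : Irreducible g) :
    ∃ (Q : Type u) (_ : Field Q) (_ : Algebra k Q), ∃ T X : Q,
      ∀ t x : E, GenericPt g t x → ∃ φ : Q →ₐ[k] E, φ T = t ∧ φ X = x ∧
        φ.fieldRange ≤ IntermediateField.adjoin k {t, x} := by
  let I : Ideal (MvPolynomial (Fin 2) k) := Ideal.span {g}
  have : I.IsPrime := (Ideal.span_singleton_prime hg.ne_zero).mpr hg.prime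
  let S := MvPolynomial (Fin 2) k ⧸ I
  refine ⟨FractionRing S, inferInstance, inferInstance, algebraMap S _ (Ideal.Quotient.mk I (X 0)),
    algebraMap S _ (Ideal.Quotient.mk I (X 1)), ?_⟩
  intro t x h
  let ψ : S →ₐ[k] E := Ideal.Quotient.liftₐ I (aeval ![t, x]) (by
    intro a ha
    rw [Ideal.mem_span_singleton] at ha
    exact (generic_dvd hg h.zero h.gen a).mpr ha)
  have hψm : ∀ a, ψ (Ideal.Quotient.mk I a) = aeval ![t, x] a := fun a => rfl
  have hψ : Function.Injective ψ := by
    rw [injective_iff_map_eq_zero]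
    intro a ha
    obtain ⟨a, rfl⟩ := Ideal.Quotient.mk_surjective a
    rw [hψm, generic_dvd hg h.zero h.gen, ← Ideal.mem_span_singleton] at ha
    exact Ideal.Quotient.eq_zero_iff_mem.mpr ha
  let φ : FractionRing S →ₐ[k] E := IsFractionRing.liftAlgHom (g := ψ) hψ
  have hφ : ∀ a, φ (algebraMap S _ a) = ψ a := fun a => IsFractionRing.lift_algebraMap hψ a
  refine ⟨φ, ?_, ?_, ?_⟩
  · rw [hφ, hψm]; simp
  · rw [hφ, hψm]; simp
  · rintro _ ⟨q, rfl⟩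
    obtain ⟨a, b, hb, rfl⟩ := IsFractionRing.div_surjective (A := S) q
    have hmem : ∀ a : S, ψ a ∈ IntermediateField.adjoin k {t, x} := by
      intro a
      obtain ⟨a, rfl⟩ := Ideal.Quotient.mk_surjective a
      rw [hψm]
      exact IntermediateField.algebra_adjoin_le_adjoin _ _ (aeval_mem_adjoin t x a)
    change φ _ ∈ _
    rw [map_div₀, hφ, hφ]
    exact div_mem (hmem _) (hmem _)

theorem aut_lemma {g : MvPolynomial (Fin 2) k} (hg : Irreducible g) {t x t' x' : E}
    (h : GenericPt g t x) (h' : GenericPt g t' x')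
    (ha : Algebra.IsAlgebraic (IntermediateField.adjoin k {t, x}) E)
    (ha' : Algebra.IsAlgebraic (IntermediateField.adjoin k {t', x'}) E) :
    ∃ σ : E ≃ₐ[k] E, σ t = t' ∧ σ x = x' := by
  obtain ⟨Q, _, _, T, X, hQ⟩ := exists_hom (E := E) hg
  obtain ⟨φ, hT, hX, -⟩ := hQ t x h
  obtain ⟨φ', hT', hX', -⟩ := hQ t' x' h'
  have cl : ∀ (φ : Q →ₐ[k] E) (t x : E), φ T = t → φ X = x →
      Algebra.IsAlgebraic (IntermediateField.adjoin k {t, x}) E → ∀ y : E, IsAlgebraic φ.fieldRange y := by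
    intro φ t x hT hX ha y
    refine isAlgebraic_of_subset (IntermediateField.adjoin k {t, x}) _ ?_ y (ha.isAlgebraic y)
    change IntermediateField.adjoin k {t, x} ≤ φ.fieldRange
    rw [IntermediateField.adjoin_le_iff]
    rintro z (rfl | rfl)
    · exact ⟨T, hT⟩
    · exact ⟨X, hX⟩
  have c1 := cl φ t x hT hX ha
  have c2 := cl φ' t' x' hT' hX' ha'
  let e : φ.fieldRange ≃ₐ[k] φ'.fieldRange :=
    (AlgEquiv.ofInjectiveField φ).symm.trans (AlgEquiv.ofInjectiveField φ')
  obtain ⟨σ, hσ'⟩ := extend_equiv _ _ c1 c2 e.toRingEquiv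
  have hσ : ∀ q, σ (φ q) = φ' q := by
    intro q
    have h1 := hσ' (AlgEquiv.ofInjectiveField φ q)
    have h2 : e.toRingEquiv (AlgEquiv.ofInjectiveField φ q) = AlgEquiv.ofInjectiveField φ' q := by
      change (AlgEquiv.ofInjectiveField φ') ((AlgEquiv.ofInjectiveField φ).symm _) = _
      rw [AlgEquiv.symm_apply_apply]
    rw [h2] at h1
    exact h1
  refine ⟨AlgEquiv.ofRingEquiv (f := σ) (fun c => ?_), ?_, ?_⟩
  · have := hσ (algebraMap k Q c)
    simpa using this
  · change σ t = t'
    rw [← hT, hσ, hT']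
  · change σ x = x'
    rw [← hX, hσ, hX']
end Aut

section Trans
variable {k E : Type*} [Field k] [Field E] [Algebra k E] [IsAlgClosed k] [IsAlgClosed E]

theorem two_trans {A B : E} (hi : AlgebraicIndependent k ![A, B])
    (hE : Algebra.IsAlgebraic (IntermediateField.adjoin k {A, B}) E)
    {f : MvPolynomial (Fin 2) k} (hf : Irreducible f) {s t s' t' : E} (hst : s ≠ t) (hst' : s' ≠ t')
    (hs : aeval ![s, A * s + B] f = 0) (ht : aeval ![t, A * t + B] f = 0)
    (hs' : aeval ![s', A * s' + B] f = 0) (ht' : aeval ![t', A * t' + B] f = 0) :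
    ∃ σ : E ≃ₐ[k] E, σ A = A ∧ σ B = B ∧ σ s = s' ∧ σ t = t' := by
  have halg : ∀ {k1 : Type _} [Field k1] [Algebra k1 E] (L1 : IntermediateField k1 E)
      (_ : ∀ c : k, algebraMap k E c ∈ L1) (_ : A ∈ L1) (_ : B ∈ L1), Algebra.IsAlgebraic L1 E := by
    intro k1 _ _ L1 h0 h1 h2
    refine ⟨fun y => isAlgebraic_of_subset _ _ ?_ y (hE.isAlgebraic y)⟩
    intro z hz
    induction hz using IntermediateField.adjoin_induction with
    | mem x hx => rcases hx with rfl | rfl <;> assumption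
    | algebraMap c => exact h0 c
    | add x y _ _ hx hy => exact add_mem hx hy
    | inv x _ hx => exact inv_mem hx
    | mul x y _ _ hx hy => exact mul_mem hx hy
  -- step 1
  obtain ⟨σ₁, hA1, hB1, hs1⟩ : ∃ σ : E ≃ₐ[k] E, σ A = A ∧ σ B = B ∧ σ s = s' := by
    let k1 := IntermediateField.adjoin k {A}
    have hAmem : A ∈ k1 := IntermediateField.subset_adjoin _ _ (by simp)
    let A1 : k1 := ⟨A, hAmem⟩
    have hg := irreducible_map_of_isAlgClosed (k := k1) hf
    have gen : ∀ s, aeval ![s, A * s + B] f = 0 →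
        GenericPt (f.map (algebraMap k k1)) s (A * s + B) := by
      intro s hs
      refine ⟨by rw [aeval_map_algebraMap]; exact hs, ?_⟩
      rintro ⟨h1, h2⟩
      have hB : IsAlgebraic k1 B := by
        have : B = (A * s + B) - algebraMap k1 E A1 * s := by
          change B = (A * s + B) - A * s; ring
        rw [this]
        exact h2.sub ((isAlgebraic_algebraMap A1).mul h1)
      rw [IntermediateField.isAlgebraic_adjoin_iff] at hB
      have hd : ¬ AlgebraicIndependent k ![A, A] := fun h => ne_of_algInd h rfl
      refine dep2 hd ?_ ?_ hi
      · exact isAlgebraic_of_mem (Algebra.subset_adjoin (by simp))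
      · have : ({A, A} : Set E) = {A} := by simp
        rw [this]; exact hB
    have alg : ∀ s, Algebra.IsAlgebraic (IntermediateField.adjoin k1 {s, A * s + B}) E := by
      intro s
      have hA : A ∈ IntermediateField.adjoin k1 {s, A * s + B} :=
        IntermediateField.algebraMap_mem _ A1
      have h1 : s ∈ IntermediateField.adjoin k1 {s, A * s + B} :=
        IntermediateField.subset_adjoin _ _ (by simp)
      have h2 : A * s + B ∈ IntermediateField.adjoin k1 {s, A * s + B} :=
        IntermediateField.subset_adjoin _ _ (by simp)
      refine halg _ (fun c => IntermediateField.algebraMap_mem _ (algebraMap k k1 c)) hA ?_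
      have := sub_mem h2 (mul_mem hA h1)
      simpa using this
    obtain ⟨σ, h1, h2⟩ := aut_lemma hg (gen s hs) (gen s' hs') (alg s) (alg s')
    have hA : σ A = A := σ.commutes A1
    refine ⟨σ.restrictScalars k, hA, ?_, h1⟩
    rw [map_add, map_mul, hA, h1] at h2
    exact add_left_cancel h2
  -- step 2
  set u := σ₁ t with hu
  have hus : u ≠ s' := by
    rw [← hs1, hu]
    exact fun h => hst (σ₁.injective h).symm
  have hu0 : aeval ![u, A * u + B] f = 0 := by
    have := congrArg σ₁ ht
    rw [map_zero] at this
    have h2 := aeval_pair_map (σ₁ : E →ₐ[k] E) t (A * t + B) f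
    simp only [AlgEquiv.coe_toAlgHom, map_add, map_mul, hA1, hB1] at h2
    rw [← h2, this]
  obtain ⟨σ₂, hA2, hB2, hs2, hu2⟩ : ∃ σ : E ≃ₐ[k] E, σ A = A ∧ σ B = B ∧ σ s' = s' ∧ σ u = t' := by
    set x' := A * s' + B with hx'
    let k2 := IntermediateField.adjoin k {s', x'}
    let s2 : k2 := ⟨s', IntermediateField.subset_adjoin _ _ (by simp)⟩
    let x2 : k2 := ⟨x', IntermediateField.subset_adjoin _ _ (by simp)⟩
    have hg := irreducible_map_of_isAlgClosed (k := k2) hf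
    have hAeq : ∀ u, u ≠ s' → A = ((A * u + B) - x') * (u - s')⁻¹ := by
      intro u hu
      have : u - s' ≠ 0 := sub_ne_zero.mpr hu
      rw [hx']; field_simp; ring
    have gen : ∀ u, u ≠ s' → aeval ![u, A * u + B] f = 0 →
        GenericPt (f.map (algebraMap k k2)) u (A * u + B) := by
      intro u hu hu0
      refine ⟨by rw [aeval_map_algebraMap]; exact hu0, ?_⟩
      rintro ⟨h1, h2⟩
      apply tr_lemma hf.ne_zero hs' hx' hi
      rw [← IntermediateField.isAlgebraic_adjoin_iff, hAeq u hu]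
      exact (h2.sub (isAlgebraic_algebraMap x2)).mul (h1.sub (isAlgebraic_algebraMap s2)).inv
    have alg : ∀ u, u ≠ s' → Algebra.IsAlgebraic (IntermediateField.adjoin k2 {u, A * u + B}) E := by
      intro u hu
      have h1 : u ∈ IntermediateField.adjoin k2 {u, A * u + B} :=
        IntermediateField.subset_adjoin _ _ (by simp)
      have h2 : A * u + B ∈ IntermediateField.adjoin k2 {u, A * u + B} :=
        IntermediateField.subset_adjoin _ _ (by simp)
      have hs : s' ∈ IntermediateField.adjoin k2 {u, A * u + B} :=
        IntermediateField.algebraMap_mem _ s2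
      have hx : x' ∈ IntermediateField.adjoin k2 {u, A * u + B} :=
        IntermediateField.algebraMap_mem _ x2
      have hA : A ∈ IntermediateField.adjoin k2 {u, A * u + B} := by
        have := mul_mem (sub_mem h2 hx) (inv_mem (sub_mem h1 hs))
        rwa [← hAeq u hu] at this
      refine halg _ (fun c => IntermediateField.algebraMap_mem _ (algebraMap k k2 c)) hA ?_
      have := sub_mem h2 (mul_mem hA h1)
      simpa using this
    obtain ⟨σ, h1, h2⟩ := aut_lemma hg (gen u hus hu0) (gen t' hst'.symm ht') (alg u hus)
      (alg t' hst'.symm)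
    have hs2 : σ s' = s' := σ.commutes s2
    have hx2 : σ x' = x' := σ.commutes x2
    have hA : σ A = A := by
      have := congrArg σ (hAeq u hus)
      rw [map_mul, map_inv₀, map_sub, map_sub, hs2, hx2, h1, h2, ← hAeq t' hst'.symm] at this
      exact this
    refine ⟨σ.restrictScalars k, hA, ?_, hs2, h1⟩
    rw [map_add, map_mul, hA, h1] at h2
    exact add_left_cancel h2
  refine ⟨σ₁.trans σ₂, ?_, ?_, ?_, ?_⟩
  · simp [hA1, hA2]
  · simp [hB1, hB2]
  · simp [hs1, hs2]
  · simpa [← hu] using hu2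

end Trans

section Sep
variable {k E : Type*} [Field k] [Field E] [Algebra k E]

/-- roots of `lin A B f` give generic points -/
theorem generic_of_root {A B : E} (hi : AlgebraicIndependent k ![A, B])
    {f : MvPolynomial (Fin 2) k} (hf : f ≠ 0) {s : E} (hs : aeval ![s, A * s + B] f = 0) :
    GenericPt f s (A * s + B) := by
  refine ⟨hs, ?_⟩
  rintro ⟨h1, h2⟩
  have htr := algebraicIndependent_iff.mp hi
  have hA := tr_lemma hf hs rfl hi
  -- `s, x` algebraic: pick `A` out of `k(A)`
  have : ¬ AlgebraicIndependent k ![A, A * s + B] := by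
    intro h
    have := h.algebraMap_injective
    have h3 : AlgebraicIndependent k ![A * s + B] := by
      have := h.comp ![1] (fun i j _ => Subsingleton.elim i j)
      convert this using 1
      ext i; fin_cases i; simp
    have := h3.transcendental 0
    exact this (by simpa using h2)
  refine dep2 this (isAlgebraic_of_mem (Algebra.subset_adjoin (by simp))) ?_ hi
  have e : B = (A * s + B) - A * s := by ring
  conv_rhs => rw [e]
  have hx' : IsAlgebraic (Algebra.adjoin k {A, A * s + B}) (A * s + B) :=
    isAlgebraic_of_mem (Algebra.subset_adjoin (by simp))
  have hA' : IsAlgebraic (Algebra.adjoin k {A, A * s + B}) A :=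
    isAlgebraic_of_mem (Algebra.subset_adjoin (by simp))
  have hs' : IsAlgebraic (Algebra.adjoin k {A, A * s + B}) s := h1.extendScalars
    (FaithfulSMul.algebraMap_injective _ _)
  exact hx'.sub (hA'.mul hs')

theorem deriv_ne {A B : E} (hi : AlgebraicIndependent k ![A, B])
    {f : MvPolynomial (Fin 2) k} (hf : GoodCurve f) {s : E} (hs : aeval ![s, A * s + B] f = 0) :
    aeval ![s, A * s + B] (pderiv 0 f) + A * aeval ![s, A * s + B] (pderiv 1 f) ≠ 0 := by
  intro h0
  refine hf.tangent_dep (generic_of_root hi hf.irr.ne_zero hs) h0 ?_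
  have : A * s + B - A * s = B := by ring
  rw [this]
  exact hi

end Sep

section Hensel
variable {Ω : Type*} [Field Ω]

theorem ps_isUnit_iff (y : PowerSeries Ω) : IsUnit y ↔ (PowerSeries.constantCoeff : PowerSeries Ω →+* Ω) y ≠ 0 := by
  rw [PowerSeries.isUnit_iff_constantCoeff, isUnit_iff_ne_zero]

theorem lift_simple (p : Polynomial (PowerSeries Ω)) (hu : IsUnit p.leadingCoeff) (c : Ω)
    (h0 : (p.map (PowerSeries.constantCoeff : PowerSeries Ω →+* Ω)).eval c = 0) (h1 : (p.map (PowerSeries.constantCoeff : PowerSeries Ω →+* Ω)).derivative.eval c ≠ 0) :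
    ∃ y : PowerSeries Ω, p.eval y = 0 ∧ (PowerSeries.constantCoeff : PowerSeries Ω →+* Ω) y = c := by
  obtain ⟨u, hu⟩ := hu
  let q : Polynomial (PowerSeries Ω) := Polynomial.C (↑u⁻¹ : PowerSeries Ω) * p
  have hq : q.Monic := by
    apply Polynomial.monic_C_mul_of_mul_leadingCoeff_eq_one
    rw [← hu]; simp
  have key : ∀ g : Polynomial (PowerSeries Ω), (PowerSeries.constantCoeff : PowerSeries Ω →+* Ω) (g.eval (PowerSeries.C c)) = (g.map (PowerSeries.constantCoeff : PowerSeries Ω →+* Ω)).eval c := by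
    intro g
    rw [Polynomial.eval_map, ← Polynomial.eval₂_hom]; simp
  have a1 : q.eval (PowerSeries.C c) ∈ Ideal.span {(PowerSeries.X : PowerSeries Ω)} := by
    rw [Ideal.mem_span_singleton, PowerSeries.X_dvd_iff]
    have := key q
    rw [this]; simp [q, h0]
  have a2 : IsUnit (Ideal.Quotient.mk (Ideal.span {(PowerSeries.X : PowerSeries Ω)})
      (q.derivative.eval (PowerSeries.C c))) := by
    apply IsUnit.map
    rw [ps_isUnit_iff, key]
    have hv : (PowerSeries.constantCoeff : PowerSeries Ω →+* Ω) (↑u⁻¹ : PowerSeries Ω) ≠ 0 := (ps_isUnit_iff _).mp (Units.isUnit _)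
    simp only [q, Polynomial.derivative_mul, Polynomial.derivative_C, zero_mul, zero_add,
      Polynomial.map_mul, Polynomial.map_C, Polynomial.eval_mul, Polynomial.eval_C]
    rw [← Polynomial.derivative_map]
    exact mul_ne_zero hv h1
  obtain ⟨y, hy, hy'⟩ := HenselianRing.is_henselian q hq (PowerSeries.C c) a1 a2
  refine ⟨y, ?_, ?_⟩
  · have : q.eval y = 0 := hy
    simpa [q] using this
  · rw [Ideal.mem_span_singleton, PowerSeries.X_dvd_iff] at hy'
    simpa [sub_eq_zero] using hy'

theorem lift_unique (p : Polynomial (PowerSeries Ω)) {y z : PowerSeries Ω}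
    (hy : p.eval y = 0) (hz : p.eval z = 0) (h : (PowerSeries.constantCoeff : PowerSeries Ω →+* Ω) y = (PowerSeries.constantCoeff : PowerSeries Ω →+* Ω) z)
    (h1 : (p.map (PowerSeries.constantCoeff : PowerSeries Ω →+* Ω)).derivative.eval ((PowerSeries.constantCoeff : PowerSeries Ω →+* Ω) y) ≠ 0) : y = z := by
  obtain ⟨e, he⟩ := Polynomial.binomExpansion p y (z - y)
  rw [add_sub_cancel, hz, hy] at he
  have h2 : (z - y) * (p.derivative.eval y + e * (z - y)) = 0 := by linear_combination -he
  rcases mul_eq_zero.mp h2 with h3 | h3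
  · exact (sub_eq_zero.mp h3).symm
  · exfalso
    apply h1
    have := congrArg (PowerSeries.constantCoeff : PowerSeries Ω →+* Ω) h3
    rw [map_add, map_mul, map_sub, h, sub_self, mul_zero, add_zero, map_zero] at this
    rw [Polynomial.derivative_map, Polynomial.eval_map, Polynomial.eval₂_hom]
    exact this

variable {L E : Type*} [Field L] [Field E] [Algebra (PowerSeries Ω) L]
  [IsFractionRing (PowerSeries Ω) L] [Algebra L E] [Algebra (PowerSeries Ω) E]
  [IsScalarTower (PowerSeries Ω) L E]

theorem root_mem (p : Polynomial (PowerSeries Ω)) (hu : IsUnit p.leadingCoeff) {l : L}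
    (hl : Polynomial.aeval l p = 0) : ∃ y : PowerSeries Ω, algebraMap (PowerSeries Ω) L y = l := by
  obtain ⟨u, hu⟩ := hu
  apply IsIntegrallyClosed.isIntegral_iff.mp
  refine ⟨Polynomial.C (↑u⁻¹ : PowerSeries Ω) * p, ?_, ?_⟩
  · apply Polynomial.monic_C_mul_of_mul_leadingCoeff_eq_one
    rw [← hu]; simp
  · rw [← Polynomial.aeval_def]; simp [hl]

open Classical in
/-- number of roots in the power series ring -/
theorem card_roots_ps (p : Polynomial (PowerSeries Ω)) (hu : IsUnit p.leadingCoeff)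
    (S : Finset Ω) (hS : ∀ c ∈ S, (p.map (PowerSeries.constantCoeff : PowerSeries Ω →+* Ω)).eval c = 0 ∧ (p.map (PowerSeries.constantCoeff : PowerSeries Ω →+* Ω)).derivative.eval c ≠ 0)
    (hS' : ∀ y : PowerSeries Ω, p.eval y = 0 → (PowerSeries.constantCoeff : PowerSeries Ω →+* Ω) y ∈ S) :
    p.roots.toFinset.card = S.card := by
  have hp : p ≠ 0 := by rintro rfl; simp at hu
  apply Finset.card_bij (fun y _ => (PowerSeries.constantCoeff : PowerSeries Ω →+* Ω) y)
  · intro y hy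
    simp [hp] at hy
    exact hS' y hy
  · intro y hy z hz h
    simp [hp] at hy hz
    exact lift_unique p hy hz h (hS _ (hS' y hy)).2
  · intro c hc
    obtain ⟨y, hy, hy'⟩ := lift_simple p hu c (hS c hc).1 (hS c hc).2
    exact ⟨y, by simpa [hp] using hy, hy'⟩

end Hensel

section Count
variable {k : Type*} [Field k] [IsAlgClosed k]

open Classical in
theorem card_simple (q : Polynomial k) (hq : q ≠ 0)
    (h : ∀ y, q.eval y = 0 → q.derivative.eval y ≠ 0) : q.roots.toFinset.card = q.natDegree := by
  rw [← IsAlgClosed.card_roots_eq_natDegree, Multiset.toFinset_card_of_nodup]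
  rw [Multiset.nodup_iff_count_le_one]
  intro a
  rw [Polynomial.count_roots]
  by_contra hc
  push Not at hc
  obtain ⟨h1, h2⟩ := (Polynomial.one_lt_rootMultiplicity_iff_isRoot hq).mp hc
  exact h a h1 h2

open Classical in
theorem card_double (q : Polynomial k) (hq : q ≠ 0) (t : k) (h0 : q.eval t = 0)
    (h1 : q.derivative.eval t = 0) (h2 : q.derivative.derivative.eval t ≠ 0)
    (h : ∀ y, y ≠ t → q.eval y = 0 → q.derivative.eval y ≠ 0) :
    (q.roots.toFinset.erase t).card + 2 = q.natDegree := by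
  rw [← IsAlgClosed.card_roots_eq_natDegree]
  have ht : t ∈ q.roots.toFinset := by simp [hq, h0]
  conv_rhs => rw [← Multiset.toFinset_sum_count_eq, ← Finset.add_sum_erase _ _ ht]
  have e1 : q.roots.count t = 2 := by
    rw [Polynomial.count_roots]
    apply le_antisymm
    · by_contra hc
      push Not at hc
      exact h2 (Polynomial.isRoot_iterate_derivative_of_lt_rootMultiplicity (n := 2) hc)
    · exact (Polynomial.one_lt_rootMultiplicity_iff_isRoot hq).mpr ⟨h0, h1⟩
  have e2 : ∑ x ∈ q.roots.toFinset.erase t, q.roots.count x =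
      ∑ x ∈ q.roots.toFinset.erase t, 1 := by
    apply Finset.sum_congr rfl
    intro x hx
    obtain ⟨hx1, hx2⟩ := Finset.mem_erase.mp hx
    rw [Multiset.mem_toFinset] at hx2
    apply le_antisymm
    · rw [Polynomial.count_roots]
      by_contra hc
      push Not at hc
      obtain ⟨h1, h2⟩ := (Polynomial.one_lt_rootMultiplicity_iff_isRoot hq).mp hc
      exact h x hx1 h1 h2
    · exact Multiset.one_le_count_iff_mem.mpr hx2
  rw [e1, e2]
  simp
  ring

end Count

section Swap
variable {Ω : Type*} [Field Ω] [IsAlgClosed Ω]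

theorem inj_E (L : Type*) {E : Type*} [Field L] [Field E] [Algebra (PowerSeries Ω) L]
    [IsFractionRing (PowerSeries Ω) L] [Algebra L E] [Algebra (PowerSeries Ω) E]
    [IsScalarTower (PowerSeries Ω) L E] : Function.Injective (algebraMap (PowerSeries Ω) E) := by
  rw [IsScalarTower.algebraMap_eq (PowerSeries Ω) L E]
  exact (algebraMap L E).injective.comp (IsFractionRing.injective _ _)

open Classical in
theorem all_in_range (L : Type*) {E : Type*} [Field L] [Field E] [Algebra (PowerSeries Ω) L]
    [IsFractionRing (PowerSeries Ω) L] [Algebra L E] [Algebra (PowerSeries Ω) E]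
    [IsScalarTower (PowerSeries Ω) L E]
    (p : Polynomial (PowerSeries Ω)) (hu : IsUnit p.leadingCoeff)
    (h : ∀ y, (p.map (PowerSeries.constantCoeff : PowerSeries Ω →+* Ω)).eval y = 0 → (p.map (PowerSeries.constantCoeff : PowerSeries Ω →+* Ω)).derivative.eval y ≠ 0) (y : E)
    (hy : Polynomial.aeval y p = 0) : ∃ z, algebraMap (PowerSeries Ω) E z = y := by
  have hp : p ≠ 0 := by rintro rfl; simp at hu
  have hinj := inj_E (Ω := Ω) L (E := E)
  have hp1 : p.map (PowerSeries.constantCoeff : PowerSeries Ω →+* Ω) ≠ 0 := by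
    intro h0
    have := (hu.map (PowerSeries.constantCoeff : PowerSeries Ω →+* Ω)).ne_zero
    rw [Polynomial.leadingCoeff, ← Polynomial.coeff_map, h0] at this
    simp at this
  have c1 := card_roots_ps p hu (p.map (PowerSeries.constantCoeff : PowerSeries Ω →+* Ω)).roots.toFinset
    (fun c hc => by
      simp only [Multiset.mem_toFinset, Polynomial.mem_roots hp1, Polynomial.IsRoot.def] at hc
      exact ⟨hc, h c hc⟩)
    (fun y hy => by
      simp only [Multiset.mem_toFinset, Polynomial.mem_roots hp1, Polynomial.IsRoot.def]
      rw [Polynomial.eval_map, Polynomial.eval₂_hom, hy, map_zero])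
  rw [card_simple _ hp1 h, Polynomial.natDegree_map_eq_of_isUnit_leadingCoeff _ hu] at c1
  have hp2 : p.map (algebraMap (PowerSeries Ω) E) ≠ 0 := by
    rwa [Ne, Polynomial.map_eq_zero_iff hinj]
  have sub : p.roots.toFinset.image (algebraMap (PowerSeries Ω) E) ⊆
      (p.map (algebraMap (PowerSeries Ω) E)).roots.toFinset := by
    intro z hz
    obtain ⟨w, hw, rfl⟩ := Finset.mem_image.mp hz
    simp only [Multiset.mem_toFinset, Polynomial.mem_roots hp, Polynomial.mem_roots hp2,
      Polynomial.IsRoot.def] at hw ⊢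
    rw [Polynomial.eval_map, Polynomial.eval₂_hom, hw, map_zero]
  have := Finset.eq_of_subset_of_card_le sub (by
    rw [Finset.card_image_of_injective _ hinj, c1,
      ← Polynomial.natDegree_map_eq_of_injective hinj]
    exact (Multiset.toFinset_card_le _).trans (Polynomial.card_roots' _))
  have hy' : y ∈ (p.map (algebraMap (PowerSeries Ω) E)).roots.toFinset := by
    simp only [Multiset.mem_toFinset, Polynomial.mem_roots hp2,
      Polynomial.IsRoot.def]
    rwa [Polynomial.eval_map, ← Polynomial.aeval_def]
  rw [← this] at hy'
  obtain ⟨z, -, hz⟩ := Finset.mem_image.mp hy'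
  exact ⟨z, hz⟩

variable {L E : Type*} [Field L] [Field E] [Algebra (PowerSeries Ω) L]
  [IsFractionRing (PowerSeries Ω) L] [Algebra L E] [Algebra (PowerSeries Ω) E]
  [IsScalarTower (PowerSeries Ω) L E]
variable [IsAlgClosed E] [Algebra.IsAlgebraic L E]

open Classical in
theorem swap_abs (p : Polynomial (PowerSeries Ω)) (hu : IsUnit p.leadingCoeff)
    (hE : ∀ y : E, Polynomial.aeval y p = 0 → Polynomial.aeval y p.derivative ≠ 0) (t : Ω)
    (h0 : (p.map (PowerSeries.constantCoeff : PowerSeries Ω →+* Ω)).eval t = 0)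
    (h1 : (p.map (PowerSeries.constantCoeff : PowerSeries Ω →+* Ω)).derivative.eval t = 0) (h2 : (p.map (PowerSeries.constantCoeff : PowerSeries Ω →+* Ω)).derivative.derivative.eval t ≠ 0)
    (h : ∀ y, y ≠ t → (p.map (PowerSeries.constantCoeff : PowerSeries Ω →+* Ω)).eval y = 0 → (p.map (PowerSeries.constantCoeff : PowerSeries Ω →+* Ω)).derivative.eval y ≠ 0)
    (ht : ∀ y, p.eval y = 0 → (PowerSeries.constantCoeff : PowerSeries Ω →+* Ω) y ≠ t) :
    ∃ σ : E ≃ₐ[L] E, ∃ y1 y2 : E, y1 ≠ y2 ∧ Polynomial.aeval y1 p = 0 ∧ Polynomial.aeval y2 p = 0 ∧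
      σ y1 = y2 ∧ ∀ y : E, Polynomial.aeval y p = 0 → y ≠ y1 → y ≠ y2 → σ y = y := by
  have hp : p ≠ 0 := by rintro rfl; simp at hu
  have hinj := inj_E (Ω := Ω) L (E := E)
  have hp1 : p.map (PowerSeries.constantCoeff : PowerSeries Ω →+* Ω) ≠ 0 := by
    intro h0
    have := (hu.map (PowerSeries.constantCoeff : PowerSeries Ω →+* Ω)).ne_zero
    rw [Polynomial.leadingCoeff, ← Polynomial.coeff_map, h0] at this
    simp at this
  have c1 := card_roots_ps p hu ((p.map (PowerSeries.constantCoeff : PowerSeries Ω →+* Ω)).roots.toFinset.erase t)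
    (fun c hc => by
      simp only [Finset.mem_erase, Multiset.mem_toFinset, Polynomial.mem_roots hp1,
        Polynomial.IsRoot.def] at hc
      exact ⟨hc.2, h c hc.1 hc.2⟩)
    (fun y hy => by
      simp only [Finset.mem_erase, Multiset.mem_toFinset, Polynomial.mem_roots hp1,
        Polynomial.IsRoot.def]
      refine ⟨ht y hy, ?_⟩
      rw [Polynomial.eval_map, Polynomial.eval₂_hom, hy, map_zero])
  have c2 := card_double _ hp1 t h0 h1 h2 h
  rw [← c1, Polynomial.natDegree_map_eq_of_isUnit_leadingCoeff _ hu] at c2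
  have hp2 : p.map (algebraMap (PowerSeries Ω) E) ≠ 0 := by
    rwa [Ne, Polynomial.map_eq_zero_iff hinj]
  set T := (p.map (algebraMap (PowerSeries Ω) E)).roots.toFinset with hT
  have memT : ∀ y, y ∈ T ↔ Polynomial.aeval y p = 0 := by
    intro y
    simp only [hT, Multiset.mem_toFinset, Polynomial.mem_roots hp2, Polynomial.IsRoot.def]
    rw [Polynomial.eval_map, ← Polynomial.aeval_def]
  set S := p.roots.toFinset.image (algebraMap (PowerSeries Ω) E) with hS
  have sub : S ⊆ T := by
    intro z hz
    obtain ⟨w, hw, rfl⟩ := Finset.mem_image.mp hz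
    simp only [Multiset.mem_toFinset, Polynomial.mem_roots hp,
      Polynomial.IsRoot.def] at hw
    rw [memT, Polynomial.aeval_algebraMap_apply, Polynomial.coe_aeval_eq_eval, hw, map_zero]
  have c3 : T.card = p.natDegree := by
    rw [hT, card_simple _ hp2, Polynomial.natDegree_map_eq_of_injective hinj]
    intro y hy
    rw [Polynomial.derivative_map, Polynomial.eval_map, ← Polynomial.aeval_def]
    rw [Polynomial.eval_map, ← Polynomial.aeval_def] at hy
    exact hE y hy
  have c4 : (T \ S).card = 2 := by
    have := Finset.card_sdiff_add_card_eq_card sub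
    have hSc : S.card = p.roots.toFinset.card := Finset.card_image_of_injective _ hinj
    omega
  obtain ⟨y1, y2, hne, hy⟩ := Finset.card_eq_two.mp c4
  have m1 : y1 ∈ T \ S := by rw [hy]; simp
  have m2 : y2 ∈ T \ S := by rw [hy]; simp
  have r1 := (memT y1).mp (Finset.mem_sdiff.mp m1).1
  have r2 := (memT y2).mp (Finset.mem_sdiff.mp m2).1
  have nL : ∀ l : L, algebraMap L E l ≠ y1 := by
    rintro l rfl
    have hl : Polynomial.aeval l p = 0 := by
      apply (algebraMap L E).injective
      rw [← Polynomial.aeval_algebraMap_apply, r1, map_zero]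
    obtain ⟨z, rfl⟩ := root_mem p hu hl
    apply (Finset.mem_sdiff.mp m1).2
    rw [hS, Finset.mem_image]
    refine ⟨z, ?_, IsScalarTower.algebraMap_apply _ _ _ _⟩
    simp only [Multiset.mem_toFinset, Polynomial.mem_roots hp,
      Polynomial.IsRoot.def]
    rw [Polynomial.aeval_algebraMap_apply, Polynomial.coe_aeval_eq_eval] at hl
    exact (map_eq_zero_iff _ (IsFractionRing.injective _ L)).mp hl
  have hyint : IsIntegral L y1 := Algebra.IsIntegral.isIntegral y1
  -- the minimal polynomial
  set μ := minpoly L y1 with hμ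
  have hdvd : μ ∣ p.map (algebraMap (PowerSeries Ω) L) := by
    apply minpoly.dvd
    rw [Polynomial.aeval_map_algebraMap]; exact r1
  have hμT : ∀ z : E, Polynomial.aeval z μ = 0 → z ∈ T := by
    intro z hz
    obtain ⟨q, hq⟩ := hdvd
    rw [memT, ← Polynomial.aeval_map_algebraMap L, hq, map_mul, hz, zero_mul]
  have hμS : ∀ z : E, Polynomial.aeval z μ = 0 → z ∉ S := by
    intro z hz hzS
    obtain ⟨w, -, rfl⟩ := Finset.mem_image.mp hzS
    rw [IsScalarTower.algebraMap_apply _ L E, Polynomial.aeval_algebraMap_apply,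
      Polynomial.coe_aeval_eq_eval, map_eq_zero] at hz
    have hd := Polynomial.degree_eq_one_of_irreducible_of_root (minpoly.irreducible hyint) hz
    obtain ⟨l, hl⟩ := minpoly.mem_range_of_degree_eq_one L y1 hd
    exact nL l hl
  have hconj : IsConjRoot L y1 y2 := by
    rw [isConjRoot_iff_aeval_eq_zero hyint]
    by_contra hc
    have only : ∀ z : E, Polynomial.aeval z μ = 0 → z = y1 := by
      intro z hz
      have : z ∈ T \ S := Finset.mem_sdiff.mpr ⟨hμT z hz, hμS z hz⟩
      rw [hy, Finset.mem_insert, Finset.mem_singleton] at this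
      rcases this with h | rfl
      · exact h
      · exact absurd hz hc
    have hμ0 : μ.map (algebraMap L E) ≠ 0 := Polynomial.map_ne_zero (minpoly.ne_zero hyint)
    have hcard := card_simple (μ.map (algebraMap L E)) hμ0 (by
      intro z hz
      rw [Polynomial.derivative_map, Polynomial.eval_map, ← Polynomial.aeval_def]
      rw [Polynomial.eval_map, ← Polynomial.aeval_def] at hz
      intro hz'
      refine hE z ((memT z).mp (hμT z hz)) ?_
      obtain ⟨q, hq⟩ := hdvd
      rw [← Polynomial.aeval_map_algebraMap L, ← Polynomial.derivative_map, hq,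
        Polynomial.derivative_mul, map_add, map_mul, map_mul, hz, hz', zero_mul, zero_mul, add_zero])
    have hsub : (μ.map (algebraMap L E)).roots.toFinset ⊆ {y1} := by
      intro z hz
      simp only [Multiset.mem_toFinset, Polynomial.mem_roots hμ0, Polynomial.IsRoot.def] at hz
      rw [Polynomial.eval_map, ← Polynomial.aeval_def] at hz
      exact Finset.mem_singleton.mpr (only z hz)
    have hle := Finset.card_le_card hsub
    rw [hcard, Polynomial.natDegree_map, Finset.card_singleton] at hle
    have hd : μ.natDegree = 1 := le_antisymm hle (minpoly.natDegree_pos hyint)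
    obtain ⟨l, hl⟩ := minpoly.mem_range_of_degree_eq_one L y1
      ((Polynomial.degree_eq_iff_natDegree_eq_of_pos one_pos).mpr hd)
    exact nL l hl
  have : IsAlgClosure L E := ⟨inferInstance, inferInstance⟩
  have : Normal L E := IsAlgClosure.normal L E
  obtain ⟨σ, hσ⟩ := (isConjRoot_iff_exists_algEquiv).mp hconj.symm
  refine ⟨σ, y1, y2, hne, r1, r2, hσ, ?_⟩
  intro y hyp n1 n2
  have : y ∈ S := by
    by_contra hc
    have : y ∈ T \ S := Finset.mem_sdiff.mpr ⟨(memT y).mpr hyp, hc⟩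
    rw [hy, Finset.mem_insert, Finset.mem_singleton] at this
    tauto
  obtain ⟨w, -, rfl⟩ := Finset.mem_image.mp this
  rw [IsScalarTower.algebraMap_apply _ L E]
  exact σ.commutes _

end Swap

section Deg
variable {K : Type*} [Field K]

/-- The polynomial giving the top coefficient of `lin a b f`. -/
noncomputable def topPoly (f : MvPolynomial (Fin 2) K) : Polynomial K :=
  ∑ m ∈ f.support.filter (fun m => m 0 + m 1 = f.totalDegree),
    Polynomial.monomial (m 1) (f.coeff m)

theorem topPoly_ne {f : MvPolynomial (Fin 2) K} (hf : f ≠ 0) : topPoly f ≠ 0 := by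
  have hne : f.support.Nonempty := by simpa [Finset.nonempty_iff_ne_empty] using hf
  obtain ⟨m, hm, hmd⟩ := Finset.exists_mem_eq_sup f.support hne (fun s => s.sum fun _ e => e)
  have e2 : ∀ s : Fin 2 →₀ ℕ, (s.sum fun _ e => e) = s 0 + s 1 := by
    intro s
    rw [Finsupp.sum_fintype _ _ (by simp)]; simp
  have hmd' : m 0 + m 1 = f.totalDegree := by
    rw [← e2, ← hmd]; rfl
  intro h0
  have h1 := congrArg (fun q => Polynomial.coeff q (m 1)) h0
  simp only [topPoly, Polynomial.finset_sum_coeff, Polynomial.coeff_zero] at h1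
  rw [Finset.sum_eq_single m] at h1
  · rw [Polynomial.coeff_monomial, if_pos rfl] at h1
    exact (mem_support_iff.mp hm) h1
  · intro s hs hsm
    rw [Polynomial.coeff_monomial, if_neg]
    intro h
    apply hsm
    have := (Finset.mem_filter.mp hs).2
    ext i
    fin_cases i
    · change s 0 = m 0
      omega
    · exact h
  · intro h
    exact absurd (Finset.mem_filter.mpr ⟨hm, hmd'⟩) h

variable {R : Type*} [CommRing R] [Algebra K R]

theorem lin_monomial (a b : R) (m : Fin 2 →₀ ℕ) (c : K) :
    lin a b (monomial m c) = Polynomial.C (algebraMap K R c) *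
      (Polynomial.X ^ (m 0) * (Polynomial.C a * Polynomial.X + Polynomial.C b) ^ (m 1)) := by
  rw [lin, aeval_monomial, Finsupp.prod_fintype _ _ (by simp)]
  simp [Polynomial.algebraMap_apply]

theorem lin_monomial_natDegree_le (a b : R) (m : Fin 2 →₀ ℕ) (c : K) :
    (lin a b (monomial m c)).natDegree ≤ m 0 + m 1 := by
  rw [lin_monomial]
  refine (Polynomial.natDegree_C_mul_le _ _).trans (Polynomial.natDegree_mul_le.trans ?_)
  gcongr
  · exact Polynomial.natDegree_X_pow_le _
  · refine Polynomial.natDegree_pow_le.trans ?_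
    have := Polynomial.natDegree_linear_le (a := a) (b := b)
    nlinarith

theorem lin_monomial_coeff (a b : R) (m : Fin 2 →₀ ℕ) (c : K) :
    (lin a b (monomial m c)).coeff (m 0 + m 1) = algebraMap K R c * a ^ (m 1) := by
  rw [lin_monomial, Polynomial.coeff_C_mul, Nat.add_comm, Polynomial.coeff_X_pow_mul]
  congr 1
  have := Polynomial.coeff_pow_of_natDegree_le (m := m 1)
    (Polynomial.natDegree_linear_le (a := a) (b := b))
  rw [mul_one] at this
  rw [this]; simp

theorem lin_eq_sum (a b : R) (f : MvPolynomial (Fin 2) K) :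
    lin a b f = ∑ m ∈ f.support, lin a b (monomial m (f.coeff m)) := by
  conv_lhs => rw [f.as_sum]
  simp only [lin, map_sum]

theorem le_of_mem_support2 {f : MvPolynomial (Fin 2) K} {m : Fin 2 →₀ ℕ} (hm : m ∈ f.support) :
    m 0 + m 1 ≤ f.totalDegree := by
  have := le_totalDegree hm
  rwa [Finsupp.sum_fintype _ _ (by simp), Fin.sum_univ_two] at this

theorem lin_natDegree_le (a b : R) (f : MvPolynomial (Fin 2) K) :
    (lin a b f).natDegree ≤ f.totalDegree := by
  rw [lin_eq_sum]
  apply Polynomial.natDegree_sum_le_of_forall_le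
  intro m hm
  exact (lin_monomial_natDegree_le a b m _).trans (le_of_mem_support2 hm)

theorem lin_coeff (a b : R) (f : MvPolynomial (Fin 2) K) :
    (lin a b f).coeff f.totalDegree = Polynomial.aeval a (topPoly f) := by
  rw [lin_eq_sum, topPoly, map_sum, Finset.sum_filter, Polynomial.finset_sum_coeff]
  apply Finset.sum_congr rfl
  intro m hm
  split_ifs with h
  · rw [← h, lin_monomial_coeff, Polynomial.aeval_monomial]
  · apply Polynomial.coeff_eq_zero_of_natDegree_lt
    have := lin_monomial_natDegree_le a b m (f.coeff m)
    have := le_of_mem_support2 hm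
    omega

theorem lin_natDegree [Nontrivial R] {a : R} (b : R) {f : MvPolynomial (Fin 2) K}
    (h : Polynomial.aeval a (topPoly f) ≠ 0) : (lin a b f).natDegree = f.totalDegree := by
  apply le_antisymm (lin_natDegree_le a b f)
  apply Polynomial.le_natDegree_of_ne_zero
  rwa [lin_coeff]

end Deg

section Indep
universe u
variable {k Ω : Type*} [Field k] [Field Ω] [Algebra k Ω]

theorem algInd_pair_of {R : Type*} [CommRing R] [Algebra k R] {A B : R} (hA : Transcendental k A)
    (hB : Transcendental (Algebra.adjoin k {A}) B) : AlgebraicIndependent k ![A, B] := by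
  have h1 : AlgebraicIndependent k (fun _ : Unit => A) := by
    rw [algebraicIndependent_unique_type_iff]; exact hA
  have h2 := (h1.option_iff_transcendental B).mpr (by
    rw [Set.range_const]; exact hB)
  have h3 := h2.comp ![some (), none] (by
    intro i j hij
    fin_cases i <;> fin_cases j <;> simp_all)
  convert h3 using 1
  ext i; fin_cases i <;> rfl

theorem algebraMap_ps (c : k) :
    algebraMap k (PowerSeries Ω) c = PowerSeries.C (algebraMap k Ω c) := by
  rw [PowerSeries.algebraMap_apply]

theorem ps_eval₂ (b : Ω) (q : Polynomial Ω)
    (hq : q.eval₂ (PowerSeries.C : Ω →+* PowerSeries Ω) (PowerSeries.C b + PowerSeries.X) = 0) :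
    q = 0 := by
  have h : ∀ g : Polynomial Ω, g.eval₂ (PowerSeries.C : Ω →+* PowerSeries Ω)
      (PowerSeries.C b + PowerSeries.X) = ((Polynomial.taylor b g : Polynomial Ω) : PowerSeries Ω) := by
    intro g
    induction g using Polynomial.induction_on' with
    | add p q hp hq => rw [Polynomial.eval₂_add, hp, hq, map_add, Polynomial.coe_add]
    | monomial n a =>
      rw [Polynomial.eval₂_monomial, Polynomial.taylor_monomial, Polynomial.coe_mul,
        Polynomial.coe_C, Polynomial.coe_pow, Polynomial.coe_add, Polynomial.coe_C,
        Polynomial.coe_X, add_comm]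
  rw [h, Polynomial.coe_eq_zero_iff] at hq
  exact Polynomial.taylor_injective b (by rw [hq, map_zero])

theorem algInd_ps {a : Ω} (b : Ω) (ha : Transcendental k a) :
    AlgebraicIndependent k ![(PowerSeries.C a : PowerSeries Ω), PowerSeries.C b + PowerSeries.X] := by
  let Cc : Ω →ₐ[k] PowerSeries Ω := ⟨PowerSeries.C, fun c => (algebraMap_ps c).symm⟩
  apply algInd_pair_of
  · intro h
    apply ha
    exact (isAlgebraic_algHom_iff Cc (PowerSeries.C_injective)).mp h
  · rintro ⟨p, hp, hp0⟩
    have hS : ∀ s : Algebra.adjoin k {(PowerSeries.C a : PowerSeries Ω)},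
        PowerSeries.C (PowerSeries.constantCoeff (s : PowerSeries Ω)) = (s : PowerSeries Ω) := by
      rintro ⟨s, hs⟩
      have : Algebra.adjoin k {(PowerSeries.C a : PowerSeries Ω)} ≤ Cc.range := by
        rw [Algebra.adjoin_le_iff, Set.singleton_subset_iff]
        exact ⟨a, rfl⟩
      obtain ⟨w, rfl⟩ := this hs
      change PowerSeries.C (PowerSeries.constantCoeff (PowerSeries.C w)) = PowerSeries.C w
      simp
    let ψ : Algebra.adjoin k {(PowerSeries.C a : PowerSeries Ω)} →+* Ω :=
      (PowerSeries.constantCoeff).comp (Subalgebra.val _).toRingHom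
    have hψ : Function.Injective ψ := by
      intro s s' h
      apply Subtype.ext
      rw [← hS s, ← hS s']
      exact congrArg _ h
    apply hp
    rw [← Polynomial.map_eq_zero_iff hψ]
    apply ps_eval₂ b
    rw [Polynomial.eval₂_map]
    convert hp0 using 1
    rw [Polynomial.aeval_def]
    congr 1
    ext1 s
    exact hS s

theorem exists_genericPt {k : Type u} [Field k] [IsAlgClosed k] {f : MvPolynomial (Fin 2) k}
    (hf : GoodCurve f) : ∃ (Ω : Type u) (_ : Field Ω) (_ : Algebra k Ω) (_ : IsAlgClosed Ω),
      ∃ t x : Ω, GenericPt f t x := by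
  let I : Ideal (MvPolynomial (Fin 2) k) := Ideal.span {f}
  have : I.IsPrime := (Ideal.span_singleton_prime hf.irr.ne_zero).mpr hf.irr.prime
  let Ω' := AlgebraicClosure (FractionRing (MvPolynomial (Fin 2) k ⧸ I))
  let φ : MvPolynomial (Fin 2) k →ₐ[k] Ω' :=
    ((IsScalarTower.toAlgHom k (FractionRing (MvPolynomial (Fin 2) k ⧸ I)) Ω').comp
    (IsScalarTower.toAlgHom k (MvPolynomial (Fin 2) k ⧸ I)
      (FractionRing (MvPolynomial (Fin 2) k ⧸ I)))).comp (Ideal.Quotient.mkₐ k I)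
  have hφ : ∀ g, φ g = 0 ↔ f ∣ g := by
    intro g
    rw [← Ideal.mem_span_singleton]
    change algebraMap (FractionRing (MvPolynomial (Fin 2) k ⧸ I)) Ω'
      (algebraMap _ (FractionRing (MvPolynomial (Fin 2) k ⧸ I)) (Ideal.Quotient.mk I g)) = 0 ↔ _
    rw [map_eq_zero, map_eq_zero_iff _ (IsFractionRing.injective _ _), Ideal.Quotient.eq_zero_iff_mem]
  have hev : ∀ g, aeval ![φ (X 0), φ (X 1)] g = φ g := by
    intro g
    rw [← aeval_pair_map]
    congr 1
    have : (![X 0, X 1] : Fin 2 → MvPolynomial (Fin 2) k) = X := by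
      ext1 i; fin_cases i <;> rfl
    rw [this, aeval_X_left_apply]
  refine ⟨Ω', inferInstance, inferInstance, inferInstance, φ (X 0), φ (X 1), ⟨by rw [hev, hφ], ?_⟩⟩
  rintro ⟨h1, h2⟩
  obtain ⟨c1, hc1⟩ := mem_range_of_isAlgebraic h1
  obtain ⟨c2, hc2⟩ := mem_range_of_isAlgebraic h2
  have d1 : f ∣ X 0 - C c1 := by
    rw [← hφ, map_sub, ← hc1, sub_eq_zero]
    exact (φ.commutes c1).symm
  have d2 : f ∣ X 1 - C c2 := by
    rw [← hφ, map_sub, ← hc2, sub_eq_zero]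
    exact (φ.commutes c2).symm
  have hz : eval ![c1, c2] f = 0 := by
    have h0 : φ f = 0 := (hφ f).mpr dvd_rfl
    rw [← hev, ← hc1, ← hc2] at h0
    have := aeval_pair_map (Algebra.ofId k Ω') c1 c2 f
    have e : aeval ![c1, c2] f = eval ![c1, c2] f := by rw [aeval_eq_eval]
    rw [e] at this
    have h3 : Algebra.ofId k Ω' (eval ![c1, c2] f) = 0 := by
      rw [this]; exact h0
    exact (map_eq_zero_iff _ (algebraMap k Ω').injective).mp h3
  obtain ⟨q1, hq1⟩ := d1
  obtain ⟨q2, hq2⟩ := d2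
  have e1 := congrArg (fun g => eval ![c1, c2] (pderiv 0 g)) hq1
  have e2 := congrArg (fun g => eval ![c1, c2] (pderiv 1 g)) hq1
  have e3 := congrArg (fun g => eval ![c1, c2] (pderiv 1 g)) hq2
  simp only [pderiv_mul, map_sub, map_add, map_mul, hz, zero_mul, add_zero, pderiv_C, map_zero,
    sub_zero] at e1 e2 e3
  rw [pderiv_X_self, map_one] at e1 e3
  rw [pderiv_X_of_ne (by decide), map_zero] at e2
  rcases mul_eq_zero.mp e2.symm with h | h
  · simp [h] at e3
  · simp [h] at e1

end Indep

section SwapC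
universe u

theorem swap_generic {k Ω L E : Type*} [Field k] [IsAlgClosed k] [Field Ω] [IsAlgClosed Ω]
    [Algebra k Ω] [Field L] [Field E] [Algebra (PowerSeries Ω) L]
    [IsFractionRing (PowerSeries Ω) L] [Algebra L E] [Algebra (PowerSeries Ω) E]
    [IsScalarTower (PowerSeries Ω) L E] [IsAlgClosed E] [Algebra.IsAlgebraic L E]
    [Algebra k E] [IsScalarTower k (PowerSeries Ω) E]
    {ι : Type*} (f : ι → MvPolynomial (Fin 2) k) (hf : ∀ i, GoodCurve (f i))
    (hna : ∀ i j, i ≠ j → ¬ f i ∣ f j) (i : ι) {t x : Ω} (h : GenericPt (f i) t x) :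
    ∃ A B : E, AlgebraicIndependent k ![A, B] ∧ ∃ σ : E ≃+* E,
      (∀ c : k, σ (algebraMap k E c) = algebraMap k E c) ∧ σ A = A ∧ σ B = B ∧
      ∃ y1 y2 : E, y1 ≠ y2 ∧ aeval ![y1, A * y1 + B] (f i) = 0 ∧
        aeval ![y2, A * y2 + B] (f i) = 0 ∧ σ y1 = y2 ∧
        ∀ j y, aeval ![y, A * y + B] (f j) = 0 → (j = i → y ≠ y1 ∧ y ≠ y2) → σ y = y := by
  have hX := (hf i).fX_ne h
  set fT := aeval ![t, x] (pderiv 0 (f i)) with hfT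
  set fX := aeval ![t, x] (pderiv 1 (f i)) with hfX
  obtain ⟨a, ha⟩ : ∃ a : Ω, fT + a * fX = 0 := ⟨-fT / fX, by field_simp; ring⟩
  have htr : Transcendental k a := by
    intro hc
    obtain ⟨c, hc⟩ := mem_range_of_isAlgebraic hc
    exact (hf i).slope_transc h ha c hc.symm
  set b := x - a * t with hb
  let ccA : PowerSeries Ω →ₐ[k] Ω := ⟨PowerSeries.constantCoeff, fun c => by
    rw [algebraMap_ps]; simp⟩
  let CA : Ω →ₐ[k] PowerSeries Ω := ⟨PowerSeries.C, fun c => (algebraMap_ps c).symm⟩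
  let A0 : PowerSeries Ω := PowerSeries.C a
  let B0 : PowerSeries Ω := PowerSeries.C b + PowerSeries.X
  have hind0 : AlgebraicIndependent k ![A0, B0] := algInd_ps b htr
  let φ : PowerSeries Ω →ₐ[k] E := IsScalarTower.toAlgHom k (PowerSeries Ω) E
  have hφinj : Function.Injective φ := inj_E (Ω := Ω) L (E := E)
  let A : E := φ A0
  let B : E := φ B0
  have hind : AlgebraicIndependent k ![A, B] := by
    have := hind0.map' (f := φ) hφinj
    convert this using 1
    ext i; fin_cases i <;> rfl
  let p : ι → Polynomial (PowerSeries Ω) := fun j => lin A0 B0 (f j)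
  have hpcc : ∀ j, (p j).map (PowerSeries.constantCoeff : PowerSeries Ω →+* Ω) = lin a b (f j) := by
    intro j
    have := lin_map A0 B0 (f j) ccA
    have e1 : ccA A0 = a := by simp [ccA, A0]
    have e2 : ccA B0 = b := by simp [ccA, B0]
    rw [e1, e2] at this
    exact this
  have hpE : ∀ j (y : E), Polynomial.aeval y (p j) = aeval ![y, A * y + B] (f j) := by
    intro j y
    have := lin_map A0 B0 (f j) φ
    rw [← lin_eval, ← this, Polynomial.eval_map, Polynomial.aeval_def]
    rfl
  have hpE' : ∀ j (y : E), Polynomial.aeval y (p j).derivative =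
      aeval ![y, A * y + B] (pderiv 0 (f j)) + A * aeval ![y, A * y + B] (pderiv 1 (f j)) := by
    intro j y
    have := lin_map A0 B0 (f j) φ
    rw [← lin_eval, ← lin_eval, ← Polynomial.eval_C (a := A) (x := y), ← Polynomial.eval_mul,
      ← Polynomial.eval_add, Polynomial.eval_C, ← lin_derivative, ← this,
      Polynomial.derivative_map, Polynomial.eval_map, Polynomial.aeval_def]
    rfl
  have hder : ∀ j (y : Ω), (lin a b (f j)).derivative.eval y =
      aeval ![y, a * y + b] (pderiv 0 (f j)) + a * aeval ![y, a * y + b] (pderiv 1 (f j)) := by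
    intro j y
    rw [lin_derivative, Polynomial.eval_add, Polynomial.eval_mul, Polynomial.eval_C, lin_eval,
      lin_eval]
  have hu : ∀ j, IsUnit (p j).leadingCoeff := by
    intro j
    have h1 : Polynomial.aeval a (topPoly (f j)) ≠ 0 := fun h0 =>
      topPoly_ne (hf j).irr.ne_zero ((transcendental_iff.mp htr) _ h0)
    have h2 : PowerSeries.C (Polynomial.aeval a (topPoly (f j))) =
        Polynomial.aeval A0 (topPoly (f j)) :=
      (Polynomial.aeval_algHom_apply CA a (topPoly (f j))).symm
    have h3 : Polynomial.aeval A0 (topPoly (f j)) ≠ 0 := by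
      rw [← h2]; intro h0; apply h1; exact PowerSeries.C_injective (by rw [h0, map_zero])
    have h4 : (p j).leadingCoeff = Polynomial.aeval A0 (topPoly (f j)) := by
      rw [Polynomial.leadingCoeff, lin_natDegree B0 h3, lin_coeff]
    rw [h4, ← h2, ps_isUnit_iff]
    simpa using h1
  have hx : a * t + b = x := by rw [hb]; ring
  have hsimple : ∀ j y, (lin a b (f j)).eval y = 0 → (lin a b (f j)).derivative.eval y = 0 →
      y = t ∧ f i ∣ f j := by
    intro j y h1 h2
    rw [lin_eval] at h1
    rw [hder] at h2
    exact no_bitangent (hf i) (hf j) h ha h1 h2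
  obtain ⟨σ, y1, y2, hne, hr1, hr2, hσ, hrest⟩ := swap_abs (L := L) (E := E) (p i) (hu i) (by
      intro y hy
      rw [hpE] at hy
      rw [hpE']
      exact deriv_ne hind (hf i) hy) t
    (by rw [hpcc, lin_eval, hx]; exact h.zero)
    (by rw [hpcc, hder, hx]; exact ha)
    (by
      rw [hpcc, lin_derivative, Polynomial.derivative_add, Polynomial.derivative_mul,
        Polynomial.derivative_C, lin_derivative, lin_derivative]
      simp only [Polynomial.eval_add, Polynomial.eval_mul, Polynomial.eval_C, lin_eval, hx,
        Polynomial.eval_zero]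
      rw [pderiv_pderiv_comm 1 0 (f i)]
      have := (hf i).second_ne h ha
      convert this using 1
      ring)
    (by
      intro y hyt h1 h2
      rw [hpcc] at h1 h2
      exact hyt (hsimple i y h1 h2).1)
    (by
      intro y hy hyt
      have : PowerSeries.X ∣ y - PowerSeries.C t := by
        rw [PowerSeries.X_dvd_iff]; simp [hyt]
      obtain ⟨w, hw⟩ := this
      have hy1 : y = PowerSeries.C t + PowerSeries.X * w := by rw [← hw]; ring
      have hy2 : A0 * y + B0 = PowerSeries.C x + PowerSeries.X * (PowerSeries.C a * w + 1) := by
        rw [hy1, ← hx]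
        simp only [A0, B0, map_add, map_mul]
        ring
      rw [lin_eval, hy2] at hy
      rw [hy1] at hy
      obtain ⟨e, he⟩ := taylor2 (f i) (PowerSeries.C t) (PowerSeries.C x) w
        (PowerSeries.C a * w + 1) PowerSeries.X
      rw [hy] at he
      have hC : ∀ g, aeval ![(PowerSeries.C t : PowerSeries Ω), PowerSeries.C x] g =
          PowerSeries.C (aeval ![t, x] g) := fun g => (aeval_pair_map CA t x g).symm
      rw [hC, hC, hC, h.zero, map_zero, ← hfT, ← hfX] at he
      have haC := congrArg (PowerSeries.C : Ω →+* PowerSeries Ω) ha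
      rw [map_add, map_mul, map_zero] at haC
      have h5 : PowerSeries.X * (PowerSeries.C fX + PowerSeries.X * e) = 0 := by
        linear_combination -he - PowerSeries.X * w * haC
      rcases mul_eq_zero.mp h5 with h6 | h6
      · exact PowerSeries.X_ne_zero h6
      · have := congrArg (PowerSeries.constantCoeff : PowerSeries Ω →+* Ω) h6
        simp at this
        exact hX this)
  have hR : ∀ z : PowerSeries Ω, σ (algebraMap (PowerSeries Ω) E z) =
      algebraMap (PowerSeries Ω) E z := by
    intro z
    rw [IsScalarTower.algebraMap_apply _ L E, σ.commutes]
  refine ⟨A, B, hind, σ.toRingEquiv, ?_, hR A0, hR B0, y1, y2, hne, ?_, ?_, hσ, ?_⟩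
  · intro c
    have := hR (algebraMap k _ c)
    rw [← IsScalarTower.algebraMap_apply k (PowerSeries Ω) E] at this
    exact this
  · rw [← hpE]; exact hr1
  · rw [← hpE]; exact hr2
  · intro j y hy hji
    rw [← hpE] at hy
    by_cases hj : j = i
    · subst hj
      exact hrest y hy (hji rfl).1 (hji rfl).2
    · obtain ⟨z, rfl⟩ := all_in_range L (p j) (hu j) (by
        intro y h1 h2
        rw [hpcc] at h1 h2
        exact hna i j (Ne.symm hj) (hsimple j y h1 h2).2) y hy
      exact hR z

theorem swap_concrete {k : Type u} [Field k] [IsAlgClosed k]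
    {ι : Type*} (f : ι → MvPolynomial (Fin 2) k) (hf : ∀ i, GoodCurve (f i))
    (hna : ∀ i j, i ≠ j → ¬ f i ∣ f j) (i : ι) :
    ∃ (E : Type u) (_ : Field E) (_ : Algebra k E) (_ : IsAlgClosed E),
    ∃ A B : E, AlgebraicIndependent k ![A, B] ∧ ∃ σ : E ≃+* E,
      (∀ c : k, σ (algebraMap k E c) = algebraMap k E c) ∧ σ A = A ∧ σ B = B ∧
      ∃ y1 y2 : E, y1 ≠ y2 ∧ aeval ![y1, A * y1 + B] (f i) = 0 ∧
        aeval ![y2, A * y2 + B] (f i) = 0 ∧ σ y1 = y2 ∧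
        ∀ j y, aeval ![y, A * y + B] (f j) = 0 → (j = i → y ≠ y1 ∧ y ≠ y2) → σ y = y := by
  obtain ⟨Ω, _, _, _, t, x, h⟩ := exists_genericPt (hf i)
  exact ⟨AlgebraicClosure (FractionRing (PowerSeries Ω)), inferInstance, inferInstance,
    inferInstance, swap_generic (L := FractionRing (PowerSeries Ω)) f hf hna i h⟩

end SwapC

section Grp

open Classical in
theorem surj_of_swaps {G ι : Type*} [Group G] [Finite ι] {Z : ι → Type*} [∀ i, Finite (Z i)]
    (Φ : G →* (∀ i, Equiv.Perm (Z i)))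
    (h1 : ∀ i (s t s' t' : Z i), s ≠ t → s' ≠ t' → ∃ g, Φ g i s = s' ∧ Φ g i t = t')
    (h2 : ∀ i, ∃ g, ∃ y1 y2 : Z i, y1 ≠ y2 ∧ Φ g i y1 = y2 ∧
      ∀ j (y : Z j), (∀ h : j = i, h ▸ y ≠ y1 ∧ h ▸ y ≠ y2) → Φ g j y = y) :
    Function.Surjective Φ := by
  have key : ∀ i (τ : Equiv.Perm (Z i)), Pi.mulSingle i τ ∈ Φ.range := by
    intro i
    obtain ⟨g, y1, y2, hne, hg, hrest⟩ := h2 i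
    have hr : ∀ y : Z i, y ≠ y1 → y ≠ y2 → Φ g i y = y := fun y a b => hrest i y (fun _ => ⟨a, b⟩)
    have hy2 : Φ g i y2 = y1 := by
      by_contra hc
      by_cases hc2 : Φ g i y2 = y2
      · apply hne
        apply (Φ g i).injective
        rw [hg, hc2]
      · have := hr _ hc hc2
        exact hc2 ((Φ g i).injective this)
    have hsw : Φ g = Pi.mulSingle i (Equiv.swap y1 y2) := by
      funext j
      ext y
      by_cases hj : j = i
      · subst hj
        rw [Pi.mulSingle_eq_same]
        by_cases e1 : y = y1
        · rw [e1, Equiv.swap_apply_left, hg]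
        · by_cases e2 : y = y2
          · rw [e2, Equiv.swap_apply_right, hy2]
          · rw [Equiv.swap_apply_of_ne_of_ne e1 e2, hr y e1 e2]
      · rw [Pi.mulSingle_eq_of_ne hj, Equiv.Perm.one_apply]
        exact hrest j y (fun h => absurd h hj)
    have hall : ∀ a b : Z i, a ≠ b → Pi.mulSingle i (Equiv.swap a b) ∈ Φ.range := by
      intro a b hab
      obtain ⟨h, ha, hb⟩ := h1 i y1 y2 a b hne hab
      refine ⟨h * g * h⁻¹, ?_⟩
      rw [map_mul, map_mul, map_inv, hsw]
      funext j
      by_cases hj : j = i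
      · subst hj
        simp only [Pi.mul_apply, Pi.inv_apply, Pi.mulSingle_eq_same]
        rw [← Equiv.swap_apply_apply, ha, hb]
      · simp only [Pi.mul_apply, Pi.inv_apply, Pi.mulSingle_eq_of_ne hj]
        simp
    have htop : Φ.range.comap (MonoidHom.mulSingle (fun i => Equiv.Perm (Z i)) i) = ⊤ := by
      rw [eq_top_iff, ← Equiv.Perm.closure_isSwap, Subgroup.closure_le]
      rintro τ ⟨a, b, hab, rfl⟩
      exact hall a b hab
    intro τ
    have : τ ∈ Φ.range.comap (MonoidHom.mulSingle (fun i => Equiv.Perm (Z i)) i) := by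
      rw [htop]; trivial
    exact this
  intro x
  exact Subgroup.pi_mem_of_mulSingle_mem (H := Φ.range) x (fun i => key i (x i))

variable {M N : Type*} [Field M] [Field N] [Algebra M N]

theorem root_perm_iff (P : Polynomial M) (g : N ≃ₐ[M] N) (y : N) :
    Polynomial.aeval (g y) P = 0 ↔ Polynomial.aeval y P = 0 := by
  have : Polynomial.aeval (g y) P = g (Polynomial.aeval y P) :=
    Polynomial.aeval_algHom_apply g.toAlgHom y P
  rw [this, map_eq_zero_iff _ g.injective]

/-- action on roots -/
def rootHom (P : Polynomial M) :
    (N ≃ₐ[M] N) →* Equiv.Perm {y : N // Polynomial.aeval y P = 0} where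
  toFun g := Equiv.Perm.subtypePerm g.toEquiv (fun y => root_perm_iff P g y)
  map_one' := by ext; rfl
  map_mul' _ _ := by ext; rfl

theorem gal_prod {ι : Type*} [Finite ι] (P : ι → Polynomial M) (d : ι → ℕ)
    (hP : ∀ i, P i ≠ 0)
    (hcard : ∀ i, Nat.card {y : N // Polynomial.aeval y (P i) = 0} = d i)
    (hext : ∀ g h : N ≃ₐ[M] N, (∀ i y, Polynomial.aeval y (P i) = 0 → g y = h y) → g = h)
    (h1 : ∀ i (s t s' t' : N), s ≠ t → s' ≠ t' → Polynomial.aeval s (P i) = 0 →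
      Polynomial.aeval t (P i) = 0 → Polynomial.aeval s' (P i) = 0 →
      Polynomial.aeval t' (P i) = 0 → ∃ g : N ≃ₐ[M] N, g s = s' ∧ g t = t')
    (h2 : ∀ i, ∃ g : N ≃ₐ[M] N, ∃ y1 y2 : N, y1 ≠ y2 ∧ Polynomial.aeval y1 (P i) = 0 ∧
      Polynomial.aeval y2 (P i) = 0 ∧ g y1 = y2 ∧
      ∀ j y, Polynomial.aeval y (P j) = 0 → (j = i → y ≠ y1 ∧ y ≠ y2) → g y = y) :
    Nonempty ((N ≃ₐ[M] N) ≃* (∀ i, Equiv.Perm (Fin (d i)))) := by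
  classical
  have hfin : ∀ i, Finite {y : N // Polynomial.aeval y (P i) = 0} := by
    intro i
    apply Set.Finite.to_subtype
    apply Set.Finite.subset (Polynomial.rootSet_finite (P i) N)
    intro y hy
    exact (Polynomial.mem_rootSet_of_ne (hP i)).mpr hy
  let Φ : (N ≃ₐ[M] N) →* (∀ i, Equiv.Perm {y : N // Polynomial.aeval y (P i) = 0}) :=
    MonoidHom.pi (fun i => rootHom (P i))
  have hΦ : ∀ g i y, (Φ g i y : N) = g y := fun _ _ _ => rfl
  have hinj : Function.Injective Φ := by
    intro g h hgh
    apply hext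
    intro i y hy
    have := congrArg (fun τ => ((τ i ⟨y, hy⟩ : {y : N // Polynomial.aeval y (P i) = 0}) : N)) hgh
    exact this
  have hsurj : Function.Surjective Φ := by
    apply surj_of_swaps
    · intro i s t s' t' hst hst'
      obtain ⟨g, hg, hg'⟩ := h1 i s t s' t' (fun h => hst (Subtype.ext h))
        (fun h => hst' (Subtype.ext h)) s.2 t.2 s'.2 t'.2
      exact ⟨g, Subtype.ext hg, Subtype.ext hg'⟩
    · intro i
      obtain ⟨g, y1, y2, hne, hr1, hr2, hg, hrest⟩ := h2 i
      refine ⟨g, ⟨y1, hr1⟩, ⟨y2, hr2⟩, fun h => hne (congrArg Subtype.val h), Subtype.ext hg, ?_⟩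
      intro j y hy
      apply Subtype.ext
      apply hrest j y y.2
      rintro rfl
      have := hy rfl
      exact ⟨fun h => this.1 (Subtype.ext h), fun h => this.2 (Subtype.ext h)⟩
  have e : ∀ i, Nonempty ({y : N // Polynomial.aeval y (P i) = 0} ≃ Fin (d i)) := by
    intro i
    have := hcard i
    exact ⟨Finite.equivFinOfCardEq this⟩
  exact ⟨(MulEquiv.ofBijective Φ ⟨hinj, hsurj⟩).trans
    (MulEquiv.piCongrRight fun i => (e i).some.permCongrHom)⟩

end Grp

noncomputable section Emb

universe u v w

theorem exists_E1 (k : Type u) [Field k] [IsAlgClosed k] :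
    ∃ (E : Type u) (_ : Field E) (_ : Algebra k E) (_ : IsAlgClosed E), ∃ A B : E,
      AlgebraicIndependent k ![A, B] ∧
      Algebra.IsAlgebraic (IntermediateField.adjoin k {A, B}) E := by
  let M := FractionRing (MvPolynomial (Fin 2) k)
  let E := AlgebraicClosure M
  have hX : AlgebraicIndependent k (X : Fin 2 → MvPolynomial (Fin 2) k) :=
    algebraicIndependent_X (Fin 2) k
  let φ : MvPolynomial (Fin 2) k →ₐ[k] E :=
    (IsScalarTower.toAlgHom k M E).comp (IsScalarTower.toAlgHom k (MvPolynomial (Fin 2) k) M)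
  have hφ : Function.Injective φ := by
    intro x y hxy
    have h1 : algebraMap M E (algebraMap _ M x) = algebraMap M E (algebraMap _ M y) := hxy
    exact IsFractionRing.injective (MvPolynomial (Fin 2) k) M ((algebraMap M E).injective h1)
  have hi : AlgebraicIndependent k ![φ (X 0), φ (X 1)] := by
    have h := hX.map' hφ
    have h2 : (φ ∘ (X : Fin 2 → MvPolynomial (Fin 2) k)) = ![φ (X 0), φ (X 1)] := by
      funext i; fin_cases i <;> rfl
    rwa [h2] at h
  refine ⟨E, inferInstance, inferInstance, inferInstance, φ (X 0), φ (X 1), hi, ⟨fun y => ?_⟩⟩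
  have hpoly : ∀ q : MvPolynomial (Fin 2) k,
      φ q ∈ IntermediateField.adjoin k {φ (X 0), φ (X 1)} := by
    intro q
    induction q using MvPolynomial.induction_on with
    | C c =>
      have : φ (C c) = algebraMap k E c := φ.commutes c
      rw [this]
      exact IntermediateField.algebraMap_mem _ c
    | add p q hp hq => rw [map_add]; exact add_mem hp hq
    | mul_X p i hp =>
      rw [map_mul]
      refine mul_mem hp (IntermediateField.subset_adjoin _ _ ?_)
      fin_cases i <;> simp
  have hy : IsAlgebraic M y := Algebra.IsAlgebraic.isAlgebraic y
  have hy2 : IsAlgebraic (⊥ : IntermediateField M E) y := hy.tower_top _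
  refine isAlgebraic_of_subset _ _ ?_ y hy2
  intro z hz
  obtain ⟨m, rfl⟩ := IntermediateField.mem_bot.mp hz
  obtain ⟨a, b, hb, rfl⟩ := IsFractionRing.div_surjective (A := MvPolynomial (Fin 2) k) m
  rw [map_div₀]
  exact div_mem (hpoly a) (hpoly b)

theorem lin_natDegree_of_ind {K : Type v} [Field K] {E : Type u} [Field E] [Algebra K E] {A B : E}
    (hi : AlgebraicIndependent K ![A, B]) {f : MvPolynomial (Fin 2) K} (hf : f ≠ 0) :
    (lin A B f).natDegree = f.totalDegree := by
  apply lin_natDegree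
  have hA : Transcendental K A := by
    have := hi.transcendental 0
    simpa using this
  intro h
  exact topPoly_ne hf ((transcendental_iff.mp hA) _ h)

theorem embed {K : Type v} [Field K] {k : Type w} [Field k] [Algebra K k] {E : Type u} [Field E]
    [Algebra k E] [IsAlgClosed E] {A B : E} (hi : AlgebraicIndependent k ![A, B])
    {r : ℕ} (f : Fin r → MvPolynomial (Fin 2) K) (hf : ∀ i, (f i).totalDegree ≠ 0) :
    ∃ ι : (lineSubAB (∏ i, f i)).SplittingField →+* E,
      (∀ σ : E ≃+* E, (∀ c : k, σ (algebraMap k E c) = algebraMap k E c) → σ A = A → σ B = B →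
        ∃ g : (lineSubAB (∏ i, f i)).SplittingField ≃ₐ[FractionRing (MvPolynomial (Fin 2) K)]
          (lineSubAB (∏ i, f i)).SplittingField, ∀ y, ι (g y) = σ (ι y)) ∧
      (∀ i y, Polynomial.aeval y (lineSubAB (f i)) = 0 ↔
        aeval ![ι y, A * ι y + B] ((f i).map (algebraMap K k)) = 0) ∧
      (∀ i z, aeval ![z, A * z + B] ((f i).map (algebraMap K k)) = 0 → ∃ y, ι y = z) ∧
      (∀ i, lineSubAB (f i) ≠ 0) := by
  classical
  let : Algebra K E := ((algebraMap k E).comp (algebraMap K k)).toAlgebra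
  have : IsScalarTower K k E := IsScalarTower.of_algebraMap_eq (fun _ => rfl)
  have hiK : AlgebraicIndependent K ![A, B] :=
    AlgebraicIndependent.restrictScalars (algebraMap K k).injective hi
  have hinj : Function.Injective (aeval ![A, B] : MvPolynomial (Fin 2) K →ₐ[K] E) := hiK
  let θ : FractionRing (MvPolynomial (Fin 2) K) →ₐ[K] E := IsFractionRing.liftAlgHom hinj
  have hθ : ∀ q, θ (algebraMap _ _ q) = aeval ![A, B] q := fun q =>
    IsFractionRing.lift_algebraMap hinj q
  let : Algebra (FractionRing (MvPolynomial (Fin 2) K)) E := (θ : FractionRing (MvPolynomial (Fin 2) K) →+* E).toAlgebra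
  have hmap : ∀ q : MvPolynomial (Fin 2) K, (lineSubAB q).map (θ : FractionRing (MvPolynomial (Fin 2) K) →+* E) = lin A B q := by
    intro q
    have := lin_map (algebraMap _ (FractionRing (MvPolynomial (Fin 2) K)) (X 0 : MvPolynomial (Fin 2) K))
      (algebraMap _ (FractionRing (MvPolynomial (Fin 2) K)) (X 1 : MvPolynomial (Fin 2) K)) q θ
    rw [hθ, hθ] at this
    simp only [aeval_X, Matrix.cons_val_zero, Matrix.cons_val_one] at this
    exact this
  have hev : ∀ (q : MvPolynomial (Fin 2) K) (z : E),
      Polynomial.aeval z (lineSubAB q) = aeval ![z, A * z + B] (q.map (algebraMap K k)) := by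
    intro q z
    rw [Polynomial.aeval_def, Polynomial.eval₂_eq_eval_map]
    change ((lineSubAB q).map (θ : FractionRing (MvPolynomial (Fin 2) K) →+* E)).eval z = _
    rw [hmap, lin_eval, aeval_map_algebraMap]
  have hprod : lineSubAB (∏ i, f i) = ∏ i, lineSubAB (f i) := lin_prod _ _ _ _
  have hne : ∀ i, lineSubAB (f i) ≠ 0 := by
    intro i h0
    have h1 := hmap (f i)
    rw [h0, Polynomial.map_zero] at h1
    have hfi : f i ≠ 0 := by
      intro h
      apply hf i
      rw [h, totalDegree_zero]
    have h2 := lin_natDegree_of_ind hiK hfi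
    rw [← h1, Polynomial.natDegree_zero] at h2
    exact hf i h2.symm
  have htot : lineSubAB (∏ i, f i) ≠ 0 := by
    rw [hprod]; exact Finset.prod_ne_zero_iff.mpr fun i _ => hne i
  let ι : (lineSubAB (∏ i, f i)).SplittingField →ₐ[FractionRing (MvPolynomial (Fin 2) K)] E :=
    Polynomial.SplittingField.lift _ (IsAlgClosed.splits _)
  refine ⟨ι, ?_, ?_, ?_, hne⟩
  · intro σ hk hA hB
    have hfix : ∀ m : FractionRing (MvPolynomial (Fin 2) K), σ (θ m) = θ m := by
      have : (σ : E →+* E).comp (θ : FractionRing (MvPolynomial (Fin 2) K) →+* E) = (θ : FractionRing (MvPolynomial (Fin 2) K) →+* E) := by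
        apply IsLocalization.ringHom_ext (nonZeroDivisors (MvPolynomial (Fin 2) K))
        apply MvPolynomial.ringHom_ext
        · intro c
          simp only [RingHom.comp_apply, RingHom.coe_coe, hθ, aeval_C]
          exact hk _
        · intro i
          simp only [RingHom.comp_apply, RingHom.coe_coe, hθ, aeval_X]
          fin_cases i <;> simpa
      intro m
      exact congrArg (fun h : _ →+* E => h m) this
    let σ' : E ≃ₐ[FractionRing (MvPolynomial (Fin 2) K)] E := AlgEquiv.ofRingEquiv (f := σ) hfix
    let : Algebra (lineSubAB (∏ i, f i)).SplittingField E := (ι : _ →+* E).toAlgebra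
    have : IsScalarTower (FractionRing (MvPolynomial (Fin 2) K))
      (lineSubAB (∏ i, f i)).SplittingField E :=
      IsScalarTower.of_algebraMap_eq (fun m => (ι.commutes m).symm)
    have : Normal (FractionRing (MvPolynomial (Fin 2) K))
      (lineSubAB (∏ i, f i)).SplittingField := Normal.of_isSplittingField (lineSubAB (∏ i, f i))
    refine ⟨σ'.restrictNormal _, fun y => ?_⟩
    exact AlgEquiv.restrictNormal_commutes σ' _ y
  · intro i y
    rw [← hev]
    change _ ↔ Polynomial.aeval (ι y) _ = 0
    rw [Polynomial.aeval_algHom_apply]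
    simp
  · intro i z hz
    rw [← hev] at hz
    have hs : ((lineSubAB (f i)).map (algebraMap _ (lineSubAB (∏ i, f i)).SplittingField)).Splits := by
      refine (Polynomial.SplittingField.splits (lineSubAB (∏ i, f i))).of_dvd ?_ ?_
      · exact (Polynomial.map_ne_zero_iff (RingHom.injective _)).mpr htot
      · apply Polynomial.map_dvd
        rw [hprod]
        exact Finset.dvd_prod_of_mem _ (Finset.mem_univ i)
    have := hs.image_rootSet ι
    have hz2 : z ∈ (lineSubAB (f i)).rootSet E := (Polynomial.mem_rootSet_of_ne (hne i)).mpr hz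
    rw [← this] at hz2
    obtain ⟨y, -, hy⟩ := hz2
    exact ⟨y, hy⟩
end Emb

noncomputable section Fin2

universe u

theorem totalDegree_map_inj {K k : Type*} [Field K] [Field k] (φ : K →+* k)
    (f : MvPolynomial (Fin 2) K) : (f.map φ).totalDegree = f.totalDegree := by
  unfold totalDegree
  rw [support_map_of_injective _ φ.injective]

theorem goodCurve_map {K : Type u} [Field K] (p : ℕ) [CharP K p] {f : MvPolynomial (Fin 2) K}
    {d : ℕ} (hdeg : f.totalDegree = d) (hd2 : 2 ≤ d) (hp : ¬ (p ∣ d * (d - 1)))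
    (hirr : AbsolutelyIrreducible f) {F : MvPolynomial (Fin 3) K}
    (hsm : IsSmoothHomogenization F f d) :
    GoodCurve (f.map (algebraMap K (AlgebraicClosure K))) := by
  obtain ⟨hF, hFf, hs⟩ := hsm
  have : CharP (AlgebraicClosure K) p :=
    charP_of_injective_algebraMap (algebraMap K (AlgebraicClosure K)).injective p
  have hd : ((d : ℕ) : AlgebraicClosure K) ≠ 0 := by
    rw [Ne, CharP.cast_eq_zero_iff (AlgebraicClosure K) p]
    exact fun h => hp (h.mul_right _)
  have hd1 : ((d - 1 : ℕ) : AlgebraicClosure K) ≠ 0 := by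
    rw [Ne, CharP.cast_eq_zero_iff (AlgebraicClosure K) p]
    exact fun h => hp (h.mul_left _)
  have hsub : subst0 1 (F.map (algebraMap K (AlgebraicClosure K))) =
      f.map (algebraMap K (AlgebraicClosure K)) := by
    rw [← hFf]
    have : ((subst0 (1 : AlgebraicClosure K)) : _ →+* MvPolynomial (Fin 2) (AlgebraicClosure K)).comp
        (MvPolynomial.map (algebraMap K (AlgebraicClosure K))) =
        (MvPolynomial.map (algebraMap K (AlgebraicClosure K))).comp
        ((aeval ![1, X 0, X 1] : MvPolynomial (Fin 3) K →ₐ[K] MvPolynomial (Fin 2) K) :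
          MvPolynomial (Fin 3) K →+* MvPolynomial (Fin 2) K) := by
      apply MvPolynomial.ringHom_ext
      · intro c
        simp [subst0, algebraMap_eq]
      · intro i
        fin_cases i <;> simp [subst0]
    exact congrArg (fun h : MvPolynomial (Fin 3) K →+* _ => h F) this
  obtain ⟨h1, h2⟩ := smooth_consequences hd2 (hF.map _) (by
    intro x hx h0
    obtain ⟨j, hj⟩ := hs x hx h0
    exact ⟨j, by rwa [pderiv_map]⟩) hsub (by rw [totalDegree_map_inj, hdeg]) hd hd1
  exact ⟨hirr, h1, h2⟩

theorem not_dvd_map {K k : Type*} [Field K] [Field k] (φ : K →+* k)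
    {f g : MvPolynomial (Fin 2) K} (hf : Irreducible (f.map φ)) (hg : Irreducible (g.map φ))
    (h : ∀ c : K, g ≠ c • f) : ¬ f.map φ ∣ g.map φ := by
  intro hd
  obtain ⟨u, hu⟩ := (hf.associated_of_dvd hg hd)
  obtain ⟨c, hc, hcu⟩ := MvPolynomial.isUnit_iff_eq_C_of_isReduced.mp u.isUnit
  rw [hcu] at hu
  have hf0 : f ≠ 0 := by
    rintro rfl
    simp at hf
  obtain ⟨m, hm⟩ := MvPolynomial.ne_zero_iff.mp hf0
  have hco : ∀ n, φ (coeff n f) * c = φ (coeff n g) := by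
    intro n
    have := congrArg (coeff n) hu
    rwa [mul_comm, coeff_C_mul, mul_comm, coeff_map, coeff_map] at this
  apply h (coeff m g / coeff m f)
  ext n
  apply φ.injective
  rw [coeff_smul, smul_eq_mul, map_mul, map_div₀, ← hco n, ← hco m]
  have : φ (coeff m f) ≠ 0 := by simpa using hm
  field_simp

theorem card_roots_line {k E : Type*} [Field k] [IsAlgClosed k] [Field E] [Algebra k E]
    [IsAlgClosed E] {A B : E}
    (hi : AlgebraicIndependent k ![A, B]) {f : MvPolynomial (Fin 2) k} (hf : GoodCurve f)
    (hd : f.totalDegree ≠ 0) :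
    Nat.card {z : E // aeval ![z, A * z + B] f = 0} = f.totalDegree := by
  classical
  have hn := lin_natDegree_of_ind hi hf.irr.ne_zero
  have h0 : lin A B f ≠ 0 := by
    intro h
    rw [h, Polynomial.natDegree_zero] at hn
    exact hd hn.symm
  rw [← hn, ← card_simple (lin A B f) h0]
  · apply Nat.subtype_card
    intro z
    rw [Multiset.mem_toFinset, Polynomial.mem_roots h0, Polynomial.IsRoot, lin_eval]
  · intro y hy
    rw [lin_eval] at hy
    rw [lin_derivative, Polynomial.eval_add, Polynomial.eval_mul, Polynomial.eval_C, lin_eval,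
      lin_eval]
    exact deriv_ne hi hf hy

end Fin2

/-- if `K` is a field of characteristic `p` and `f₁, …, f_r ∈ K[T,X]` are
pairwise non-associate absolutely irreducible polynomials with total degrees `d_i ≥ 2`,
`p ∤ d_i(d_i − 1)` and smooth homogenizations, then for `f = f₁ ⋯ f_r` the Galois group
of (the splitting field of) `f(T, A·T + B)` over `K(A,B)` is isomorphic to the direct
product `S_{d₁} × ⋯ × S_{d_r}` of symmetric groups. -/
theorem gal_lineSubAB_eq_prod_symmGroups (K : Type*) [Field K] (p : ℕ) [CharP K p]
    (r : ℕ) (f : Fin r → MvPolynomial (Fin 2) K) (d : Fin r → ℕ)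
    (hdeg : ∀ i, (f i).totalDegree = d i)
    (hd2 : ∀ i, 2 ≤ d i)
    (hp : ∀ i, ¬ (p ∣ d i * (d i - 1)))
    (hirr : ∀ i, AbsolutelyIrreducible (f i))
    (hassoc : ∀ i j, i ≠ j → ∀ c : K, f i ≠ c • f j)
    (hsm : ∀ i, ∃ F : MvPolynomial (Fin 3) K, IsSmoothHomogenization F (f i) (d i)) :
    Nonempty ((lineSubAB (∏ i, f i)).Gal ≃* ((i : Fin r) → Equiv.Perm (Fin (d i)))) := by
  have hpos : ∀ i, (f i).totalDegree ≠ 0 := fun i => by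
    have := hd2 i
    rw [hdeg i]
    omega
  have hgood : ∀ i, GoodCurve ((f i).map (algebraMap K (AlgebraicClosure K))) := by
    intro i
    obtain ⟨F, hF⟩ := hsm i
    exact goodCurve_map p (hdeg i) (hd2 i) (hp i) (hirr i) hF
  have hna : ∀ i j, i ≠ j → ¬ (f i).map (algebraMap K (AlgebraicClosure K)) ∣
      (f j).map (algebraMap K (AlgebraicClosure K)) := by
    intro i j hij
    exact not_dvd_map _ (hirr i) (hirr j) (hassoc j i (Ne.symm hij))
  have hprod : lineSubAB (∏ i, f i) = ∏ i, lineSubAB (f i) := lin_prod _ _ _ _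
  obtain ⟨E, _, _, _, A, B, hi, halg⟩ := exists_E1 (AlgebraicClosure K)
  obtain ⟨ι, hσ, hroot, hsurj, hne⟩ := embed (K := K) hi f hpos
  have hιinj : Function.Injective ι := ι.injective
  apply gal_prod (fun i => lineSubAB (f i)) d hne
  · intro i
    have hc := card_roots_line hi (hgood i) (by rw [totalDegree_map_inj]; exact hpos i)
    rw [totalDegree_map_inj, hdeg i] at hc
    rw [← hc]
    apply Nat.card_congr
    refine Equiv.ofBijective (fun y => ⟨ι y.1, (hroot i y.1).mp y.2⟩) ⟨?_, ?_⟩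
    · intro y y' h
      exact Subtype.ext (hιinj (congrArg Subtype.val h))
    · rintro ⟨z, hz⟩
      obtain ⟨y, rfl⟩ := hsurj i z hz
      exact ⟨⟨y, (hroot i y).mpr hz⟩, rfl⟩
  · intro g h hgh
    refine Polynomial.Gal.ext _ (fun y hy => ?_)
    have hy' := Polynomial.aeval_eq_zero_of_mem_rootSet hy
    have hy2 := (congrArg (Polynomial.aeval y) hprod).symm.trans hy'
    rw [map_prod, Finset.prod_eq_zero_iff] at hy2
    obtain ⟨i, -, hi⟩ := hy2
    exact hgh i y hi
  · intro i s t s' t' hst hst' hs ht hs' ht'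
    obtain ⟨σ, hA, hB, h1, h2⟩ := two_trans hi halg (hirr i) (fun h => hst (hιinj h))
      (fun h => hst' (hιinj h)) ((hroot i _).mp hs) ((hroot i _).mp ht)
      ((hroot i _).mp hs') ((hroot i _).mp ht')
    obtain ⟨g, hg⟩ := hσ σ.toRingEquiv (fun c => σ.commutes c) hA hB
    exact ⟨g, hιinj ((hg s).trans h1), hιinj ((hg t).trans h2)⟩
  · intro i
    obtain ⟨E', _, _, _, A', B', hi', σ, hk, hA, hB, y1, y2, hy12, hy1, hy2, h12, hrest⟩ :=
      swap_concrete _ hgood hna i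
    obtain ⟨ι', hσ', hroot', hsurj', -⟩ := embed (K := K) hi' f hpos
    obtain ⟨x1, rfl⟩ := hsurj' i y1 hy1
    obtain ⟨x2, rfl⟩ := hsurj' i y2 hy2
    obtain ⟨g, hg⟩ := hσ' σ hk hA hB
    refine ⟨g, x1, x2, fun h => hy12 (congrArg ι' h), (hroot' i _).mpr hy1, (hroot' i _).mpr hy2,
      ι'.injective ((hg x1).trans h12), ?_⟩
    intro j y hy hj
    apply ι'.injective
    rw [hg]
    apply hrest j _ ((hroot' j y).mp hy)
    intro hji
    exact ⟨fun h => (hj hji).1 (ι'.injective h), fun h => (hj hji).2 (ι'.injective h)⟩
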